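/- arXiv:1612.01303 — 2 statements merged into one kernel-verified Lean document; each statement's English description precedes it below -/
import Mathlib

section
/- (Klain's embedding theorem.) Let n ≥ 1 and 0 ≤ k ≤ n. Let φ be a continuous, translation-invariant, even valuation on ℝⁿ that is homogeneous of degree k. If φ(K) = 0 for every k-dimensional linear subspace E ⊆ ℝⁿ and every nonempty compact convex K ⊆ E, then φ(K) = 0 for every nonempty compact convex K ⊆ ℝⁿ. (Equivalently, the Klain map Val_k^+ → C(Gr_k) is injective.) -/
open MeasureTheory Pointwise
open scoped NNReal ENNReal

noncomputable section

/-- Euclidean `n`-space `ℝⁿ`. -/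
abbrev Eucl (n : ℕ) : Type := EuclideanSpace ℝ (Fin n)

section Generic

variable {V : Type*} [NormedAddCommGroup V] [NormedSpace ℝ V]

/-- `μ` is a valuation: whenever the union of two convex bodies `K`, `L` is again a convex
body `M` (with intersection the convex body `I`), one has `μ M + μ I = μ K + μ L`. -/
def IsValuation (μ : ConvexBody V → ℝ) : Prop :=
  ∀ K L M I : ConvexBody V,
    (M : Set V) = (K : Set V) ∪ (L : Set V) → (I : Set V) = (K : Set V) ∩ (L : Set V) →
      μ M + μ I = μ K + μ L

/-- The translate `K + x` of a convex body. -/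
def ConvexBody.translate (K : ConvexBody V) (x : V) : ConvexBody V :=
  ⟨(K : Set V) + {x}, K.convex.add (convex_singleton x),
    K.isCompact.add isCompact_singleton, K.nonempty.add (Set.singleton_nonempty x)⟩

/-- Translation invariance of a valuation. -/
def TransInv (μ : ConvexBody V → ℝ) : Prop :=
  ∀ (K : ConvexBody V) (x : V), μ (K.translate x) = μ K

/-- The dilate `t • K` of a convex body. -/
def ConvexBody.dilate (t : ℝ) (K : ConvexBody V) : ConvexBody V :=
  ⟨t • (K : Set V), K.convex.smul t, K.isCompact.smul t, K.nonempty.smul_set⟩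

/-- Homogeneity of degree `k` of a valuation: `μ (t • K) = t ^ k * μ K` for `t > 0`. -/
def Homog (k : ℕ) (μ : ConvexBody V → ℝ) : Prop :=
  ∀ (K : ConvexBody V) (t : ℝ), 0 < t → μ (ConvexBody.dilate t K) = t ^ k * μ K

/-- The reflection `-K` of a convex body. -/
def ConvexBody.reflect (K : ConvexBody V) : ConvexBody V :=
  ⟨-(K : Set V), K.convex.neg, K.isCompact.neg, K.nonempty.neg⟩

/-- Even valuations: `μ (-K) = μ K`. -/
def EvenVal (μ : ConvexBody V → ℝ) : Prop := ∀ K : ConvexBody V, μ K.reflect = μ K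

/-- Odd valuations: `μ (-K) = -μ K`. -/
def OddVal (μ : ConvexBody V → ℝ) : Prop := ∀ K : ConvexBody V, μ K.reflect = -μ K

end Generic


section Bodies

variable {V : Type*} [NormedAddCommGroup V] [NormedSpace ℝ V]

/-- If `K ∪ L` is convex, Minkowski addition of a convex set distributes over `K ∩ L`. -/
theorem inter_add_eq_of_convex_union {K L S : Set V} (hK : IsClosed K) (hL : IsClosed L)
    (hKL : Convex ℝ (K ∪ L)) (hS : Convex ℝ S) :
    (K ∩ L) + S = (K + S) ∩ (L + S) := by
  apply Set.Subset.antisymm Set.inter_add_subset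
  rintro x ⟨⟨p, hp, s, hs, hx⟩, ⟨q, hq, t, ht, hx'⟩⟩
  have hseg : segment ℝ p q ⊆ K ∪ L := hKL.segment_subset (Or.inl hp) (Or.inr hq)
  have hpre : IsPreconnected (segment ℝ p q) := (convex_segment p q).isPreconnected
  obtain ⟨m, hm, hmK, hmL⟩ := isPreconnected_closed_iff.1 hpre K L hK hL hseg
    ⟨p, left_mem_segment ℝ p q, hp⟩ ⟨q, right_mem_segment ℝ p q, hq⟩
  obtain ⟨a, b, ha, hb, hab, rfl⟩ := hm
  refine ⟨_, ⟨hmK, hmL⟩, a • s + b • t, hS hs ht ha hb hab, ?_⟩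
  change p + s = x at hx
  change q + t = x at hx'
  calc a • p + b • q + (a • s + b • t) = a • (p + s) + b • (q + t) := by module
    _ = x := by rw [hx, hx', ← add_smul, hab, one_smul]

namespace ConvexBody

/-- The one-point convex body. -/
def point (x : V) : ConvexBody V :=
  ⟨{x}, convex_singleton x, isCompact_singleton, Set.singleton_nonempty x⟩

/-- A segment as a convex body. -/
def seg (x y : V) : ConvexBody V :=
  ⟨segment ℝ x y, convex_segment x y, by
    rw [segment_eq_image]
    exact isCompact_Icc.image (by fun_prop), ⟨x, left_mem_segment ℝ x y⟩⟩

@[simp] theorem coe_point (x : V) : (point x : Set V) = {x} := rfl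

@[simp] theorem coe_seg (x y : V) : (seg x y : Set V) = segment ℝ x y := rfl

theorem translate_eq (K : ConvexBody V) (x : V) : K.translate x = K + point x := rfl

theorem exists_dist_le (K L : ConvexBody V) {x : V} (hx : x ∈ K) : ∃ y ∈ L, dist x y ≤ dist K L := by
  obtain ⟨y, hy, hxy⟩ := L.isCompact.exists_infDist_eq_dist L.nonempty x
  refine ⟨y, hy, ?_⟩
  rw [← hxy]
  exact Metric.infDist_le_hausdorffDist_of_mem hx hausdorffEDist_ne_top

theorem dist_le_of {K L : ConvexBody V} {r : ℝ} (hr : 0 ≤ r)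
    (h₁ : ∀ x ∈ K, ∃ y ∈ L, dist x y ≤ r) (h₂ : ∀ x ∈ L, ∃ y ∈ K, dist x y ≤ r) :
    dist K L ≤ r :=
  Metric.hausdorffDist_le_of_mem_dist hr h₁ h₂

theorem dist_add_left_le (K L M : ConvexBody V) : dist (K + L) (K + M) ≤ dist L M := by
  apply dist_le_of dist_nonneg
  · rintro _ ⟨a, ha, b, hb, rfl⟩
    obtain ⟨c, hc, h⟩ := exists_dist_le L M hb
    exact ⟨a + c, ⟨a, ha, c, hc, rfl⟩, by simpa using h⟩
  · rintro _ ⟨a, ha, b, hb, rfl⟩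
    obtain ⟨c, hc, h⟩ := exists_dist_le M L hb
    exact ⟨a + c, ⟨a, ha, c, hc, rfl⟩, by simpa [dist_comm] using h⟩

theorem continuous_add_left (K : ConvexBody V) : Continuous fun L : ConvexBody V => K + L :=
  (LipschitzWith.of_dist_le' (K := 1) fun L M => by
    simpa using dist_add_left_le K L M).continuous

theorem continuous_add_right (K : ConvexBody V) : Continuous fun L : ConvexBody V => L + K := by
  simpa only [add_comm _ K] using continuous_add_left K

theorem tendsto_smul_zero (K : ConvexBody V) :
    Filter.Tendsto (fun m : ℕ => ((m : ℝ) + 1)⁻¹ • K) Filter.atTop (nhds 0) := by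
  obtain ⟨R, hR, hK⟩ := K.isBounded.exists_pos_norm_le
  have hlim : Filter.Tendsto (fun m : ℕ => ((m : ℝ) + 1)⁻¹ * R) Filter.atTop (nhds 0) := by
    have := (tendsto_one_div_add_atTop_nhds_zero_nat (𝕜 := ℝ)).mul_const R
    simpa using this
  refine tendsto_iff_dist_tendsto_zero.2 (squeeze_zero (fun _ => dist_nonneg) (fun m => ?_) hlim)
  have hm : (0 : ℝ) ≤ ((m : ℝ) + 1)⁻¹ := by positivity
  have key : ∀ y ∈ K, ‖((m : ℝ) + 1)⁻¹ • y‖ ≤ ((m : ℝ) + 1)⁻¹ * R := fun y hy => by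
    rw [norm_smul, Real.norm_of_nonneg hm]
    exact mul_le_mul_of_nonneg_left (hK y hy) hm
  apply dist_le_of (by positivity)
  · rintro _ ⟨y, hy, rfl⟩
    exact ⟨0, rfl, by simpa using key y hy⟩
  · rintro _ rfl
    obtain ⟨y, hy⟩ := K.nonempty
    exact ⟨_, ⟨y, hy, rfl⟩, by simpa [dist_comm] using key y hy⟩

end ConvexBody

open ConvexBody

theorem TransInv.add_point {φ : ConvexBody V → ℝ} (h : TransInv φ) (K : ConvexBody V) (x : V) :
    φ (K + point x) = φ K := h K x

/-- `K ↦ φ (K + S)` inherits the valuation property. -/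
theorem IsValuation.add_right {φ : ConvexBody V → ℝ} (h : IsValuation φ) (S : ConvexBody V) :
    IsValuation fun K => φ (K + S) := by
  intro K L M I hM hI
  refine h _ _ _ _ ?_ ?_
  · rw [coe_add, coe_add, coe_add, hM, Set.union_add]
  · rw [coe_add, coe_add, coe_add, hI]
    exact inter_add_eq_of_convex_union K.isClosed L.isClosed (hM ▸ M.convex) S.convex

/-- The increment of `φ` under adding the segment from `0` to `v`. -/
def segIncr (φ : ConvexBody V → ℝ) (v : V) (K : ConvexBody V) : ℝ := φ (K + seg 0 v) - φ K

theorem seg_add_point (a b x : V) : seg a b + point x = seg (a + x) (b + x) := by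
  apply ConvexBody.ext
  rw [coe_add, coe_seg, coe_seg, coe_point, Set.add_singleton]
  simpa only [add_comm x] using segment_translate_image ℝ x a b

theorem segIncr_add_smul {φ : ConvexBody V → ℝ} (hval : IsValuation φ) (htrans : TransInv φ)
    (v : V) (K : ConvexBody V) {s t : ℝ} (hs : 0 ≤ s) (ht : 0 ≤ t) :
    segIncr φ ((s + t) • v) K = segIncr φ (s • v) K + segIncr φ (t • v) K := by
  have key := hval.add_right K (seg 0 (s • v)) (seg (s • v) ((s + t) • v)) (seg 0 ((s + t) • v))
    (point (s • v))
  have himg : ∀ a b : ℝ, a ≤ b → segment ℝ (a • v) (b • v) = (fun r : ℝ => r • v) '' Set.Icc a b := by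
    intro a b hab
    rw [← segment_eq_Icc hab]
    exact (image_segment ℝ (LinearMap.toSpanSingleton ℝ V v).toAffineMap a b).symm
  have h0 := himg 0 s hs
  have h1 := himg s (s + t) (by linarith)
  have h2 := himg 0 (s + t) (by linarith)
  rw [zero_smul] at h0 h2
  have e := key ?_ ?_
  · have e1 : seg (s • v) ((s + t) • v) = seg 0 (t • v) + point (s • v) := by
      rw [seg_add_point, zero_add, ← add_smul, add_comm t s]
    have e2 : φ (seg (s • v) ((s + t) • v) + K) = φ (K + seg 0 (t • v)) := by
      rw [e1, add_right_comm, htrans.add_point, add_comm]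
    have e3 : φ (point (s • v) + K) = φ K := by rw [add_comm, htrans.add_point]
    simp only [e2, e3] at e
    rw [add_comm (seg 0 ((s + t) • v)), add_comm (seg 0 (s • v))] at e
    unfold segIncr
    linarith
  · rw [coe_seg, coe_seg, coe_seg, h0, h1, h2, ← Set.image_union,
      Set.Icc_union_Icc_eq_Icc hs (by linarith)]
  · rw [coe_seg, coe_seg, coe_point, h0, h1]
    by_cases hv : v = 0
    · subst hv
      simp only [smul_zero]
      rw [Set.Nonempty.image_const ⟨0, by simp [hs]⟩, Set.Nonempty.image_const ⟨s, by simp [ht]⟩,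
        Set.inter_self]
    · rw [← Set.image_inter (smul_left_injective ℝ hv), Set.Icc_inter_Icc_eq_singleton hs (by linarith),
        Set.image_singleton]

theorem segIncr_nat_smul {φ : ConvexBody V → ℝ} (hval : IsValuation φ) (htrans : TransInv φ)
    (v : V) (K : ConvexBody V) (m : ℕ) :
    segIncr φ ((m : ℝ) • v) K = m * segIncr φ v K := by
  induction m with
  | zero =>
    have h := segIncr_add_smul hval htrans v K le_rfl (le_refl (0 : ℝ))
    simp only [add_zero] at h
    simp only [Nat.cast_zero, zero_mul]
    linarith
  | succ m ih =>
    push_cast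
    rw [segIncr_add_smul hval htrans v K (Nat.cast_nonneg m) zero_le_one, ih, one_smul]
    ring

end Bodies

section SupportFunction

open scoped RealInnerProductSpace

variable {V : Type*} [NormedAddCommGroup V] [InnerProductSpace ℝ V]

namespace ConvexBody

/-- `h` is the support function of the convex body `K`. -/
structure IsSupp (K : ConvexBody V) (h : V → ℝ) : Prop where
  le : ∀ y ∈ K, ∀ x, ⟪x, y⟫ ≤ h x
  attained : ∀ x, ∃ y ∈ K, ⟪x, y⟫ = h x

theorem exists_isSupp (K : ConvexBody V) : ∃ h, IsSupp K h := by
  have : ∀ x : V, ∃ y ∈ K, ∀ z ∈ K, ⟪x, z⟫ ≤ ⟪x, y⟫ := fun x => by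
    obtain ⟨y, hy, hmax⟩ := K.isCompact.exists_isMaxOn K.nonempty
      (f := fun y => ⟪x, y⟫) (by fun_prop)
    exact ⟨y, hy, fun z hz => hmax hz⟩
  choose y hy hmax using this
  exact ⟨fun x => ⟪x, y x⟫, fun z hz x => hmax x z hz, fun x => ⟨y x, hy x, rfl⟩⟩

theorem IsSupp.add {K L : ConvexBody V} {h g : V → ℝ} (hK : IsSupp K h) (hL : IsSupp L g) :
    IsSupp (K + L) (h + g) where
  le := by
    rintro _ ⟨a, ha, b, hb, rfl⟩ x
    simpa only [inner_add_right, Pi.add_apply] using add_le_add (hK.le a ha x) (hL.le b hb x)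
  attained x := by
    obtain ⟨a, ha, hax⟩ := hK.attained x
    obtain ⟨b, hb, hbx⟩ := hL.attained x
    exact ⟨a + b, ⟨a, ha, b, hb, rfl⟩, by rw [inner_add_right, hax, hbx, Pi.add_apply]⟩

theorem isSupp_zero : IsSupp (0 : ConvexBody V) 0 where
  le := by
    rintro y hy x
    obtain rfl : y = 0 := hy
    simp
  attained x := ⟨0, rfl, by simp⟩

theorem isSupp_seg (v : V) : IsSupp (seg (-v) v) fun x => |⟪v, x⟫| where
  le := by
    rintro _ ⟨a, b, ha, hb, hab, rfl⟩ x
    have : ⟪x, a • -v + b • v⟫ = (b - a) * ⟪v, x⟫ := by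
      rw [inner_add_right, inner_smul_right, inner_smul_right, inner_neg_right, real_inner_comm]
      ring
    rw [this]
    refine (le_abs_self _).trans ?_
    rw [abs_mul]
    exact mul_le_of_le_one_left (abs_nonneg _) (abs_le.2 ⟨by linarith, by linarith⟩)
  attained x := by
    rcases abs_choice ⟪v, x⟫ with h | h
    · exact ⟨v, right_mem_segment ℝ _ _, by rw [h, real_inner_comm]⟩
    · exact ⟨-v, left_mem_segment ℝ _ _, by rw [h, inner_neg_right, real_inner_comm]⟩

theorem IsSupp.exists_dist_le {K L : ConvexBody V} {h g : V → ℝ} (hK : IsSupp K h)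
    (hL : IsSupp L g) {ε : ℝ} (hε : 0 ≤ ε) (hle : ∀ x, h x ≤ g x + ε * ‖x‖) {x : V} (hx : x ∈ K) :
    ∃ y ∈ L, dist x y ≤ ε := by
  obtain ⟨y, hy, hxy⟩ := exists_norm_eq_iInf_of_complete_convex L.nonempty
    L.isCompact.isComplete L.convex x
  refine ⟨y, hy, ?_⟩
  have hin := (norm_eq_iInf_iff_real_inner_le_zero L.convex hy).1 hxy
  obtain ⟨z, hz, hzg⟩ := hL.attained (x - y)
  have h1 := hin z hz
  have h2 := hK.le x hx (x - y)
  have h3 := hle (x - y)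
  rw [inner_sub_right] at h1
  have h4 : ‖x - y‖ * ‖x - y‖ ≤ ε * ‖x - y‖ := by
    rw [← real_inner_self_eq_norm_mul_norm, inner_sub_right]
    linarith
  rw [dist_eq_norm]
  rcases (norm_nonneg (x - y)).eq_or_lt with h0 | h0
  · rwa [← h0]
  · exact le_of_mul_le_mul_right h4 h0

theorem IsSupp.dist_le {K L : ConvexBody V} {h g : V → ℝ} (hK : IsSupp K h)
    (hL : IsSupp L g) {ε : ℝ} (hε : 0 ≤ ε) (hle : ∀ x, |h x - g x| ≤ ε * ‖x‖) :
    dist K L ≤ ε := by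
  apply dist_le_of hε
  · exact fun x hx => hK.exists_dist_le hL hε (fun x => by linarith [(abs_le.1 (hle x)).2]) hx
  · exact fun x hx => hL.exists_dist_le hK hε (fun x => by linarith [(abs_le.1 (hle x)).1]) hx

theorem IsSupp.eq {K L : ConvexBody V} {h : V → ℝ} (hK : IsSupp K h) (hL : IsSupp L h) :
    K = L :=
  dist_le_zero.1 (hK.dist_le hL le_rfl fun x => by simp)

theorem isSupp_sum {ι : Type*} (s : Finset ι) (K : ι → ConvexBody V) (h : ι → V → ℝ)
    (hK : ∀ i, IsSupp (K i) (h i)) : IsSupp (∑ i ∈ s, K i) (∑ i ∈ s, h i) := by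
  classical
  induction s using Finset.induction_on with
  | empty => simpa using isSupp_zero
  | insert i s hi ih =>
    rw [Finset.sum_insert hi, Finset.sum_insert hi]
    exact (hK i).add ih

/-- Every sublinear function is the support function of a convex body. -/
theorem exists_of_sublinear [FiniteDimensional ℝ V] {h : V → ℝ}
    (hhom : ∀ t : ℝ, 0 < t → ∀ x, h (t • x) = t * h x)
    (hadd : ∀ x y, h (x + y) ≤ h x + h y) {C : ℝ} (hC : ∀ x, h x ≤ C * ‖x‖) :
    ∃ K, IsSupp K h := by
  have h0 : h 0 = 0 := by
    have := hhom 2 two_pos 0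
    rw [smul_zero] at this
    linarith
  have hsup : ∀ x, ∃ y : V, (∀ z, ⟪z, y⟫ ≤ h z) ∧ ⟪x, y⟫ = h x := by
    have hext : ∀ f : V →ₗ.[ℝ] ℝ, (∀ x : f.domain, f x ≤ h x) →
        ∃ y : V, (∀ z, ⟪z, y⟫ ≤ h z) ∧ ∀ x : f.domain, ⟪(x : V), y⟫ = f x := fun f hf => by
      obtain ⟨g, hg, hgh⟩ := exists_extension_of_le_sublinear f h hhom hadd hf
      have e : ∀ z, ⟪z, (InnerProductSpace.toDual ℝ V).symm (LinearMap.toContinuousLinearMap g)⟫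
          = g z := fun z => by
        rw [real_inner_comm, InnerProductSpace.toDual_symm_apply]
        rfl
      exact ⟨_, fun z => (e z).trans_le (hgh z), fun x => (e x).trans (hg x)⟩
    intro x
    by_cases hx : x = 0
    · obtain ⟨y, hy, -⟩ := hext ⟨⊥, 0⟩ (by
        rintro ⟨z, hz⟩
        obtain rfl : z = 0 := (Submodule.mem_bot ℝ).1 hz
        exact h0.ge)
      exact ⟨y, hy, by rw [hx, h0, inner_zero_left]⟩
    · obtain ⟨y, hy, hyx⟩ := hext (LinearPMap.mkSpanSingleton x (h x) hx) (by
        rintro ⟨z, hz⟩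
        obtain ⟨c, rfl⟩ := Submodule.mem_span_singleton.1 hz
        rw [LinearPMap.mkSpanSingleton'_apply, smul_eq_mul, RingHom.id_apply]
        rcases lt_trichotomy c 0 with hc | rfl | hc
        · have h1 := hadd (c • x) ((-c) • x)
          rw [hhom (-c) (by linarith), ← add_smul, add_neg_cancel, zero_smul, h0] at h1
          linarith
        · simp [h0]
        · rw [hhom c hc])
      refine ⟨y, hy, ?_⟩
      have := hyx ⟨x, Submodule.mem_span_singleton_self x⟩
      rwa [LinearPMap.mkSpanSingleton_apply] at this
  let s : Set V := {y | ∀ z, ⟪z, y⟫ ≤ h z}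
  have hclosed : IsClosed s := by
    simp only [s, Set.ofPred_forall]
    exact isClosed_iInter fun z => isClosed_le (by fun_prop) continuous_const
  have hbdd : s ⊆ Metric.closedBall 0 |C| := fun y hy => by
    rw [mem_closedBall_zero_iff]
    have h1 := (hy y).trans (hC y)
    rw [real_inner_self_eq_norm_mul_norm] at h1
    rcases (norm_nonneg y).eq_or_lt with h2 | h2
    · rw [← h2]; exact abs_nonneg C
    · exact (le_of_mul_le_mul_right h1 h2).trans (le_abs_self C)
  refine ⟨⟨s, ?_, ?_, ?_⟩, fun y hy x => hy x, hsup⟩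
  · intro y hy z hz a b ha hb hab w
    rw [inner_add_right, inner_smul_right, inner_smul_right]
    calc a * ⟪w, y⟫ + b * ⟪w, z⟫ ≤ a * h w + b * h w :=
          add_le_add (mul_le_mul_of_nonneg_left (hy w) ha) (mul_le_mul_of_nonneg_left (hz w) hb)
      _ = h w := by rw [← add_mul, hab, one_mul]
  · exact (isCompact_closedBall 0 |C|).of_isClosed_subset hclosed hbdd
  · obtain ⟨y, hy, -⟩ := hsup 0
    exact ⟨y, hy⟩

/-- A closed additive class of bodies containing all centered segments contains all zonoids. -/
theorem exists_zonoid_mem [FiniteDimensional ℝ V] [MeasurableSpace V] [BorelSpace V]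
    {Z : Set (ConvexBody V)} (hclosed : IsClosed Z) (hzero : 0 ∈ Z)
    (hadd : ∀ K ∈ Z, ∀ L ∈ Z, K + L ∈ Z) (hseg : ∀ v, seg (-v) v ∈ Z)
    (ν : Measure V) [IsFiniteMeasure ν] (hν : Integrable (fun v => v) ν) :
    ∃ K ∈ Z, IsSupp K fun x => ∫ v, |⟪v, x⟫| ∂ν := by
  have hint : ∀ x, Integrable (fun v => |⟪v, x⟫|) ν := fun x => (hν.inner_const x).abs
  obtain ⟨K, hK⟩ : ∃ K, IsSupp K fun x => ∫ v, |⟪v, x⟫| ∂ν := by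
    refine exists_of_sublinear (C := ∫ v, ‖v‖ ∂ν) ?_ ?_ ?_
    · intro t ht x
      simp only [inner_smul_right, abs_mul, abs_of_pos ht, integral_const_mul]
    · intro x y
      rw [← integral_add (hint x) (hint y)]
      refine integral_mono (hint _) ((hint x).add (hint y)) fun v => ?_
      simpa only [inner_add_right] using abs_add_le ⟪v, x⟫ ⟪v, y⟫
    · intro x
      rw [← integral_mul_const]
      exact integral_mono (hint x) (hν.norm.mul_const _) fun v => abs_real_inner_le_norm v x
  refine ⟨K, ?_, hK⟩
  let f : ℕ → SimpleFunc V V := fun n =>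
    SimpleFunc.approxOn (fun v : V => v) measurable_id (Set.range (fun v : V => v) ∪ {0}) 0 (by simp) n
  have hf : ∀ n, Integrable (f n) ν := fun n =>
    SimpleFunc.integrable_approxOn_range measurable_id hν n
  have hlim : Filter.Tendsto (fun n => ∫ v, ‖f n v - v‖ ∂ν) Filter.atTop (nhds 0) := by
    have := SimpleFunc.tendsto_approxOn_range_L1_enorm (μ := ν) measurable_id hν
    have h2 := (ENNReal.tendsto_toReal ENNReal.zero_ne_top).comp this
    refine h2.congr fun n => ?_
    exact (integral_norm_eq_lintegral_enorm ((hf n).sub hν).aestronglyMeasurable).symm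
  let W : ℕ → ConvexBody V := fun n =>
    ∑ y ∈ (f n).range, seg (-(ν.real (f n ⁻¹' {y}) • y)) (ν.real (f n ⁻¹' {y}) • y)
  have hWZ : ∀ n, W n ∈ Z := fun n =>
    Finset.sum_induction _ (· ∈ Z) (fun a b ha hb => hadd a ha b hb) hzero fun y _ => hseg _
  have hW : ∀ n, IsSupp (W n) fun x => ∫ v, |⟪f n v, x⟫| ∂ν := fun n => by
    convert isSupp_sum (f n).range _ _ (fun y => isSupp_seg (ν.real (f n ⁻¹' {y}) • y)) using 1
    ext x
    have h1 : Integrable ((f n).map fun v => |⟪v, x⟫|) ν := ((hf n).inner_const x).abs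
    have h2 := SimpleFunc.map_integral (f n) (fun v => |⟪v, x⟫|) (hf n) (by simp)
    have h3 : ∫ v, |⟪f n v, x⟫| ∂ν = _ := (SimpleFunc.integral_eq_integral _ h1).symm
    rw [h3, h2, Finset.sum_apply]
    refine Finset.sum_congr rfl fun y _ => ?_
    rw [smul_eq_mul, real_inner_smul_left, abs_mul, abs_of_nonneg measureReal_nonneg]
  refine hclosed.mem_of_tendsto (tendsto_iff_dist_tendsto_zero.2
    (squeeze_zero (fun _ => dist_nonneg) (fun n => ?_) hlim)) (Filter.Eventually.of_forall hWZ)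
  refine (hW n).dist_le hK (integral_nonneg fun v => norm_nonneg _) fun x => ?_
  rw [← integral_sub ((hf n).inner_const x).abs (hint x), ← integral_mul_const]
  refine (abs_integral_le_integral_abs).trans (integral_mono
    (((hf n).inner_const x).abs.sub (hint x)).abs (((hf n).sub hν).norm.mul_const _) fun v => ?_)
  refine (abs_abs_sub_abs_le _ _).trans ?_
  rw [← inner_sub_left]
  exact abs_real_inner_le_norm _ _

end ConvexBody

end SupportFunction

section CosineTransform

open Set Real

/-- The kernel whose integral over a half-line of dilates produces the absolute value. -/
def cosKernel (u : ℝ) : ℝ := (1 - cos (2 * π * u)) / u ^ 2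

theorem cosKernel_nonneg (u : ℝ) : 0 ≤ cosKernel u :=
  div_nonneg (sub_nonneg.2 (cos_le_one _)) (sq_nonneg u)

theorem measurable_cosKernel : Measurable cosKernel := by
  unfold cosKernel
  fun_prop

theorem cosKernel_abs (u : ℝ) : cosKernel |u| = cosKernel u := by
  unfold cosKernel
  rcases abs_cases u with h | h <;> rw [h.1]
  simp

theorem integrableOn_cosKernel : IntegrableOn cosKernel (Ioi 0) := by
  rw [← Ioc_union_Ioi_eq_Ioi (zero_le_one' ℝ)]
  refine IntegrableOn.union ?_ ?_
  · refine Measure.integrableOn_of_bounded (M := (2 * π) ^ 2 / 2) (by simp)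
      measurable_cosKernel.aestronglyMeasurable (ae_of_all _ fun u => ?_)
    rw [norm_eq_abs, abs_of_nonneg (cosKernel_nonneg u)]
    apply div_le_of_le_mul₀ (sq_nonneg u) (by positivity)
    have := one_sub_sq_div_two_le_cos (x := 2 * π * u)
    nlinarith
  · refine Integrable.mono' ((integrableOn_Ioi_rpow_of_lt (by norm_num : (-2 : ℝ) < -1)
      zero_lt_one).const_mul 2) measurable_cosKernel.aestronglyMeasurable
      ((ae_restrict_iff' measurableSet_Ioi).2 (ae_of_all _ fun u hu => ?_))
    have hu0 : (0 : ℝ) < u := zero_lt_one.trans hu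
    rw [norm_eq_abs, abs_of_nonneg (cosKernel_nonneg u), rpow_neg hu0.le, ← div_eq_mul_inv,
      rpow_ofNat]
    unfold cosKernel
    gcongr
    linarith [neg_one_le_cos (2 * π * u)]

theorem one_sub_cos_div_sq (t s : ℝ) :
    (1 - cos (2 * π * (s * t))) / s ^ 2 = t ^ 2 * cosKernel (|t| * s) := by
  rcases eq_or_ne t 0 with rfl | ht
  · simp
  have : cosKernel (|t| * s) = cosKernel (s * t) := by
    rw [← cosKernel_abs, abs_mul, abs_abs, ← abs_mul, cosKernel_abs, mul_comm]
  rw [this, cosKernel, mul_pow]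
  rcases eq_or_ne s 0 with rfl | hs
  · simp
  field_simp

theorem integrableOn_one_sub_cos_div_sq (t : ℝ) :
    IntegrableOn (fun s => (1 - cos (2 * π * (s * t))) / s ^ 2) (Ioi 0) := by
  simp_rw [one_sub_cos_div_sq t]
  rcases eq_or_ne t 0 with rfl | ht
  · simp
  refine Integrable.const_mul ?_ _
  have := (integrableOn_Ioi_comp_mul_left_iff cosKernel 0 (abs_pos.2 ht)).2
    (by simpa using integrableOn_cosKernel)
  exact this

theorem integral_one_sub_cos_div_sq (t : ℝ) :
    ∫ s in Ioi 0, (1 - cos (2 * π * (s * t))) / s ^ 2 =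
      (∫ u in Ioi 0, cosKernel u) * |t| := by
  simp_rw [one_sub_cos_div_sq t]
  rcases eq_or_ne t 0 with rfl | ht
  · simp
  rw [integral_const_mul, integral_comp_mul_left_Ioi _ _ (abs_pos.2 ht), mul_zero, smul_eq_mul,
    ← sq_abs]
  have := abs_pos.2 ht
  field_simp

variable {V : Type*} [NormedAddCommGroup V] [InnerProductSpace ℝ V] [FiniteDimensional ℝ V]
  [MeasurableSpace V] [BorelSpace V]

open scoped RealInnerProductSpace ContDiff FourierTransform

/-- An even smooth function with compact support is the cosine transform of a rapidly
decreasing function. -/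
theorem exists_eq_integral_cos {w : V → ℝ} (hw : ContDiff ℝ ∞ w) (hsupp : HasCompactSupport w)
    (heven : ∀ x, w (-x) = w x) :
    ∃ α : V → ℝ, Continuous α ∧ Integrable α ∧ Integrable (fun v => ‖v‖ * α v) ∧
      ∀ x, w x = ∫ v, cos (2 * π * ⟪v, x⟫) * α v := by
  have hW : ContDiff ℝ ∞ fun x => (w x : ℂ) := Complex.ofRealCLM.contDiff.comp hw
  have hWs : HasCompactSupport fun x => (w x : ℂ) := hsupp.comp_left (g := ((↑) : ℝ → ℂ)) rfl
  set W : SchwartzMap V ℂ := hWs.toSchwartzMap hW with hWdef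
  have hWx : ∀ x, W x = w x := fun x => rfl
  set a : SchwartzMap V ℂ := 𝓕 W with ha
  have hinv : 𝓕⁻ a = W := FourierTransform.fourierInv_fourier_eq W
  have hfor : ∀ x, (w x : ℂ) = ∫ v, Complex.exp (↑(2 * π * ⟪v, x⟫) * Complex.I) * a v := by
    intro x
    rw [← hWx, ← hinv, SchwartzMap.fourierInv_coe, Real.fourierInv_eq']
    rfl
  have hint : ∀ x, Integrable fun v => Complex.exp (↑(2 * π * ⟪v, x⟫) * Complex.I) * a v := by
    intro x
    refine a.integrable.bdd_mul (c := 1) ?_ (ae_of_all _ fun v => ?_)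
    · exact (by fun_prop : Continuous fun v : V =>
        Complex.exp (↑(2 * π * ⟪v, x⟫) * Complex.I)).aestronglyMeasurable
    · rw [Complex.norm_exp_ofReal_mul_I]
  have hcos : ∀ x, w x = ∫ v, cos (2 * π * ⟪v, x⟫) * (a v).re := by
    intro x
    have h1 : ((2 * w x : ℝ) : ℂ) = ∫ v, ((2 * cos (2 * π * ⟪v, x⟫) : ℝ) : ℂ) * a v := by
      have : ((2 * w x : ℝ) : ℂ) = w x + w (-x) := by rw [heven]; push_cast; ring
      rw [this, hfor x, hfor (-x), ← integral_add (hint x) (hint (-x))]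
      refine integral_congr_ae (ae_of_all _ fun v => ?_)
      dsimp only
      rw [inner_neg_right, ← add_mul]
      push_cast
      rw [Complex.two_cos]
      congr 3
      ring
    have h2 := congrArg Complex.re h1
    have h3 : Integrable fun v => ((2 * cos (2 * π * ⟪v, x⟫) : ℝ) : ℂ) * a v := by
      refine a.integrable.bdd_mul (c := 2) ?_ (ae_of_all _ fun v => ?_)
      · exact (by fun_prop : Continuous fun v : V =>
          ((2 * cos (2 * π * ⟪v, x⟫) : ℝ) : ℂ)).aestronglyMeasurable
      · rw [Complex.norm_real, norm_mul, norm_eq_abs, norm_eq_abs]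
        have := abs_cos_le_one (2 * π * ⟪v, x⟫)
        norm_num
        linarith
    have h4 : (∫ v, ((2 * cos (2 * π * ⟪v, x⟫) : ℝ) : ℂ) * a v).re =
        ∫ v, (((2 * cos (2 * π * ⟪v, x⟫) : ℝ) : ℂ) * a v).re := (integral_re h3).symm
    rw [h4] at h2
    simp_rw [Complex.re_ofReal_mul, mul_assoc 2 (cos _) _] at h2
    rw [integral_const_mul, Complex.ofReal_re] at h2
    linarith
  refine ⟨fun v => (a v).re, by fun_prop, a.integrable.re, ?_, hcos⟩
  refine (a.integrable_pow_mul volume 1).mono ?_ (ae_of_all _ fun v => ?_)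
  · exact (by fun_prop : Continuous fun v : V => ‖v‖ * (a v).re).aestronglyMeasurable
  · simp only [pow_one, norm_mul, norm_norm, norm_eq_abs (a v).re]
    gcongr
    exact Complex.abs_re_le_norm _

/-- Integrating dilates of `1 - cos ⟪·, x⟫` yields the absolute value of the inner product. -/
theorem integral_integral_one_sub_cos {α : V → ℝ} (hαc : Continuous α)
    (hαabs : ∀ x : V, Integrable fun v => |⟪v, x⟫| * α v) (x : V) :
    ∫ s in Ioi (0 : ℝ), ∫ v, (1 - cos (2 * π * (s * ⟪v, x⟫))) / s ^ 2 * α v =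
      (∫ u in Ioi 0, cosKernel u) * ∫ v, |⟪v, x⟫| * α v := by
  set C := ∫ u in Ioi 0, cosKernel u with hC
  let F : ℝ → V → ℝ := fun s v => (1 - cos (2 * π * (s * ⟪v, x⟫))) / s ^ 2 * α v
  rw [integral_integral_swap (f := F)]
  · simp only [F]
    simp_rw [integral_mul_const, integral_one_sub_cos_div_sq, mul_assoc]
    rw [integral_const_mul]
  · have hmeas : Measurable (Function.uncurry F) := by
      have := hαc.measurable
      have h : Measurable fun p : ℝ × V => ⟪p.2, x⟫ := by fun_prop
      unfold F Function.uncurry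
      fun_prop
    rw [integrable_prod_iff' hmeas.aestronglyMeasurable]
    have hint : ∀ v, Integrable (fun s => F s v) (volume.restrict (Ioi 0)) := fun v =>
      Integrable.mul_const (integrableOn_one_sub_cos_div_sq ⟪v, x⟫) (α v)
    refine ⟨ae_of_all _ hint, ?_⟩
    have : ∀ v, ∫ s in Ioi (0 : ℝ), ‖Function.uncurry F (s, v)‖ = C * ‖|⟪v, x⟫| * α v‖ := by
      intro v
      have : ∀ s, ‖Function.uncurry F (s, v)‖ =
          (1 - cos (2 * π * (s * ⟪v, x⟫))) / s ^ 2 * ‖α v‖ := by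
        intro s
        simp only [Function.uncurry, F, norm_mul]
        rw [norm_eq_abs, abs_of_nonneg]
        exact div_nonneg (sub_nonneg.2 (cos_le_one _)) (sq_nonneg s)
      simp_rw [this]
      rw [integral_mul_const, integral_one_sub_cos_div_sq, norm_mul, norm_eq_abs |_|, abs_abs,
        mul_assoc]
    simp_rw [this]
    exact (hαabs x).norm.const_mul C

/-- An even, positively homogeneous function which is smooth away from the origin is the
integral of `|⟪v, ·⟫|` against an integrable density with finite first moment. -/
theorem exists_eq_integral_abs_inner {H : V → ℝ} (hsmooth : ∀ x, x ≠ 0 → ContDiffAt ℝ ∞ H x)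
    (heven : ∀ x, H (-x) = H x) (hhom : ∀ t : ℝ, 0 < t → ∀ x, H (t • x) = t * H x) :
    ∃ b : V → ℝ, Continuous b ∧ Integrable b ∧ Integrable (fun v => ‖v‖ * b v) ∧
      ∀ x, H x = ∫ v, |⟪v, x⟫| * b v := by
  have hH0 : H 0 = 0 := by
    have := hhom 2 two_pos 0
    rw [smul_zero] at this
    linarith
  let η : ContDiffBump (2 : ℝ) := ⟨1 / 2, 1, by norm_num, by norm_num⟩
  have hη1 : ∀ u : ℝ, u ≤ 1 → η u = 0 := fun u hu => η.zero_of_le_dist (by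
    change 1 ≤ _
    rw [Real.dist_eq, abs_sub_comm, abs_of_nonneg] <;> linarith)
  have hη3 : ∀ u : ℝ, 3 ≤ u → η u = 0 := fun u hu => η.zero_of_le_dist (by
    change 1 ≤ _
    rw [Real.dist_eq, abs_of_nonneg] <;> linarith)
  let w : V → ℝ := fun x => η (‖x‖ ^ 2) * H x
  have hw : ContDiff ℝ ∞ w := by
    rw [contDiff_iff_contDiffAt]
    intro x
    rcases eq_or_ne x 0 with rfl | hx
    · refine (contDiffAt_const (c := (0 : ℝ))).congr_of_eventuallyEq ?_
      filter_upwards [Metric.ball_mem_nhds (0 : V) one_pos] with y hy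
      have hy1 : ‖y‖ < 1 := by simpa using hy
      have : ‖y‖ ^ 2 ≤ 1 := by nlinarith [norm_nonneg y]
      simp [w, hη1 _ this]
    · exact (η.contDiff.comp (contDiff_norm_sq ℝ)).contDiffAt.mul (hsmooth x hx)
  have hws : HasCompactSupport w := by
    refine HasCompactSupport.of_support_subset_isCompact (isCompact_closedBall (0 : V) 2) ?_
    intro x hx
    by_contra hx2
    apply hx
    have hx2 : 2 < ‖x‖ := by simpa using hx2
    have : 3 ≤ ‖x‖ ^ 2 := by nlinarith
    simp [w, hη3 _ this]
  obtain ⟨α, hαc, hα, hα1, hwα⟩ := exists_eq_integral_cos hw hws fun x => by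
    simp [w, heven]
  have hαabs : ∀ x : V, Integrable fun v => |⟪v, x⟫| * α v := by
    intro x
    refine (hα1.norm.const_mul ‖x‖).mono' (by fun_prop) (ae_of_all _ fun v => ?_)
    rw [norm_mul, norm_mul, norm_norm, norm_eq_abs |_|, abs_abs]
    have := abs_real_inner_le_norm v x
    nlinarith [norm_nonneg (α v)]
  set C := ∫ u in Ioi 0, cosKernel u with hC
  let g : ℝ → ℝ := fun u => η (u ^ 2) * (|u| / max (u ^ 2) 1)
  let c : ℝ := ∫ u in Ioi 0, g u
  have hcpos : 0 < c := by
    have hg : Continuous g := by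
      refine (η.continuous.comp (by fun_prop)).mul (Continuous.div (by fun_prop) (by fun_prop) ?_)
      intro u
      positivity
    have hgs : HasCompactSupport g := by
      refine HasCompactSupport.of_support_subset_isCompact (isCompact_closedBall (0 : ℝ) 2) ?_
      intro u hu
      by_contra hu2
      apply hu
      have hu2 : 2 < |u| := by simpa using hu2
      have : 3 ≤ u ^ 2 := by rw [← sq_abs]; nlinarith
      simp [g, hη3 _ this]
    have hpos := hg.integral_pos_of_hasCompactSupport_nonneg_nonzero (μ := volume) (x := √2) hgs
      (fun u => mul_nonneg η.nonneg (by positivity)) (by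
        have : η 2 = 1 := η.one_of_mem_closedBall (by simp [η.rIn_pos.le])
        simp only [g, Nat.ofNat_nonneg, sq_sqrt, this]
        positivity)
    have habs : ∫ u, g u = ∫ u, g |u| := by simp [g]
    rw [habs, integral_comp_abs] at hpos
    change 0 < 2 * c at hpos
    linarith
  have hleft : ∀ x, ∫ s in Ioi (0 : ℝ), w (s • x) / s ^ 2 = c * H x := by
    intro x
    rcases eq_or_ne x 0 with rfl | hx
    · simp [w, hH0]
    have hx0 := norm_pos_iff.2 hx
    have : ∀ s ∈ Ioi (0 : ℝ), w (s • x) / s ^ 2 = (‖x‖ * H x) * g (‖x‖ * s) := by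
      intro s hs
      have hs0 : (0 : ℝ) < s := hs
      simp only [w, g, norm_smul, norm_eq_abs, mul_pow, hhom s hs0, abs_mul, abs_norm,
        abs_of_pos hs0, mul_comm (s ^ 2)]
      rcases le_or_gt (‖x‖ ^ 2 * s ^ 2) 1 with h | h
      · simp [hη1 _ h]
      · rw [max_eq_left h.le]
        field_simp
    rw [setIntegral_congr_fun measurableSet_Ioi this, integral_const_mul,
      integral_comp_mul_left_Ioi _ _ hx0, mul_zero, smul_eq_mul]
    change _ * (_ * c) = _
    field_simp
  have hright : ∀ x, ∫ s in Ioi (0 : ℝ), w (s • x) / s ^ 2 = -(C * ∫ v, |⟪v, x⟫| * α v) := by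
    intro x
    let F : ℝ → V → ℝ := fun s v => (1 - cos (2 * π * (s * ⟪v, x⟫))) / s ^ 2 * α v
    have hws : ∀ s, w (s • x) / s ^ 2 = -∫ v, F s v := by
      intro s
      have h0 : ∫ v, α v = 0 := by
        have := hwα 0
        simpa [w, hH0] using this.symm
      have hcos : Integrable fun v => cos (2 * π * ⟪v, s • x⟫) * α v := by
        refine hα.bdd_mul (c := 1) ?_ (ae_of_all _ fun v => abs_cos_le_one _)
        exact (by fun_prop : Continuous fun v : V =>
          cos (2 * π * ⟪v, s • x⟫)).aestronglyMeasurable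
      have : ∀ v, F s v = (s ^ 2)⁻¹ * (α v - cos (2 * π * ⟪v, s • x⟫) * α v) := by
        intro v
        simp only [F, real_inner_smul_right]
        ring
      simp_rw [this]
      rw [integral_const_mul, integral_sub hα hcos, h0, ← hwα]
      ring
    simp_rw [hws]
    rw [integral_neg, integral_integral_one_sub_cos hαc hαabs]
  refine ⟨fun v => -(C / c) * α v, by fun_prop, hα.const_mul _, ?_, fun x => ?_⟩
  · simp_rw [mul_left_comm _ (-(C / c))]
    exact hα1.const_mul _
  · have h := (hleft x).symm.trans (hright x)
    simp_rw [mul_left_comm _ (-(C / c))]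
    rw [integral_const_mul]
    field_simp
    linarith

end CosineTransform

section Symmetric

open scoped RealInnerProductSpace ContDiff

variable {V : Type*} [NormedAddCommGroup V] [InnerProductSpace ℝ V]

namespace ConvexBody

theorem IsSupp.smul {K : ConvexBody V} {h : V → ℝ} (hK : IsSupp K h) {t : ℝ} (ht : 0 < t)
    (x : V) : h (t • x) = t * h x := by
  obtain ⟨y, hy, hxy⟩ := hK.attained x
  obtain ⟨z, hz, hxz⟩ := hK.attained (t • x)
  have h1 := hK.le y hy (t • x)
  have h2 := hK.le z hz x
  rw [real_inner_smul_left] at h1 hxz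
  nlinarith

/-- A closed cancellative class of convex bodies which contains all centred segments. -/
structure IsSegmentClass (Z : Set (ConvexBody V)) : Prop where
  isClosed : IsClosed Z
  zero_mem : 0 ∈ Z
  add_mem : ∀ K ∈ Z, ∀ L ∈ Z, K + L ∈ Z
  seg_mem : ∀ v, seg (-v) v ∈ Z
  cancel : ∀ K, ∀ L ∈ Z, K + L ∈ Z → K ∈ Z

variable {Z : Set (ConvexBody V)}

theorem IsSegmentClass.exists_isSupp_density [FiniteDimensional ℝ V] [MeasurableSpace V]
    [BorelSpace V] (hZ : IsSegmentClass Z) {b : V → ℝ} (hb : Continuous b) (hbi : Integrable b)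
    (hb1 : Integrable fun v => ‖v‖ * b v) :
    ∃ K ∈ Z, IsSupp K fun x => ∫ v, max (b v) 0 * |⟪v, x⟫| := by
  let ν : Measure V := volume.withDensity fun v => ENNReal.ofReal (b v)
  have hmeas : Measurable fun v => ENNReal.ofReal (b v) := hb.measurable.ennreal_ofReal
  have hfin : ∀ᵐ v : V, ENNReal.ofReal (b v) < ⊤ := ae_of_all _ fun v => ENNReal.ofReal_lt_top
  have : IsFiniteMeasure ν := isFiniteMeasure_withDensity_ofReal hbi.2
  have hν : Integrable (fun v => v) ν := by
    rw [integrable_withDensity_iff_integrable_smul' hmeas hfin]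
    refine hb1.mono ?_ (ae_of_all _ fun v => ?_)
    · exact (hmeas.ennreal_toReal.aestronglyMeasurable).smul
        continuous_id.aestronglyMeasurable
    · rw [norm_smul, norm_mul, norm_norm, mul_comm]
      gcongr
      rw [ENNReal.toReal_ofReal', Real.norm_eq_abs, abs_of_nonneg (le_max_right _ _)]
      exact max_le (le_abs_self _) (norm_nonneg _)
  obtain ⟨K, hKZ, hK⟩ := exists_zonoid_mem hZ.isClosed hZ.zero_mem hZ.add_mem hZ.seg_mem ν hν
  refine ⟨K, hKZ, ?_⟩
  convert hK using 2 with x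
  rw [integral_withDensity_eq_integral_toReal_smul hmeas hfin]
  simp_rw [ENNReal.toReal_ofReal', smul_eq_mul]

theorem IsSegmentClass.mem_of_smooth [FiniteDimensional ℝ V] (hZ : IsSegmentClass Z)
    {K : ConvexBody V} {h : V → ℝ} (hK : IsSupp K h)
    (hsmooth : ∀ x, x ≠ 0 → ContDiffAt ℝ ∞ h x) (heven : ∀ x, h (-x) = h x) : K ∈ Z := by
  let _ : MeasurableSpace V := borel V
  have : BorelSpace V := ⟨rfl⟩
  obtain ⟨b, hb, hbi, hb1, hrep⟩ :=
    exists_eq_integral_abs_inner hsmooth heven fun t ht x => hK.smul ht x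
  obtain ⟨Y, hYZ, hY⟩ := hZ.exists_isSupp_density hb hbi hb1
  obtain ⟨L, hLZ, hL⟩ := hZ.exists_isSupp_density (b := fun v => -b v) hb.neg hbi.neg
    (by simp only [mul_neg]; exact hb1.neg)
  have hint : ∀ c : V → ℝ, Continuous c → Integrable (fun v => ‖v‖ * c v) →
      ∀ x, Integrable fun v => c v * |⟪v, x⟫| := by
    intro c hc hc1 x
    refine (hc1.norm.const_mul ‖x‖).mono' (by fun_prop) (ae_of_all _ fun v => ?_)
    rw [norm_mul, norm_mul, norm_norm, Real.norm_eq_abs |_|, abs_abs]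
    have := abs_real_inner_le_norm v x
    nlinarith [norm_nonneg (c v)]
  have hneg : Integrable fun v => ‖v‖ * max (-b v) 0 := by
    refine hb1.mono (by fun_prop) (ae_of_all _ fun v => ?_)
    rw [norm_mul, norm_mul]
    gcongr
    rw [Real.norm_eq_abs, abs_of_nonneg (le_max_right _ _)]
    exact max_le (neg_le_abs _) (norm_nonneg _)
  have hsum : IsSupp (K + L) fun x => ∫ v, max (b v) 0 * |⟪v, x⟫| := by
    convert hK.add hL using 2 with x
    rw [Pi.add_apply, hrep x]
    simp_rw [mul_comm |_|]
    rw [← integral_add (hint b hb hb1 x) (hint (fun v => max (-b v) 0) (by fun_prop) hneg x)]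
    refine integral_congr_ae (ae_of_all _ fun v => ?_)
    simp only [← add_mul]
    congr 1
    rcases le_total (b v) 0 with h | h
    · rw [max_eq_right h, max_eq_left (by linarith)]
      ring
    · rw [max_eq_left h, max_eq_right (by linarith)]
      ring
  exact hZ.cancel K L hLZ (hsum.eq hY ▸ hYZ)

/-- The smooth approximation of the maximum of the functions `|⟪v, ·⟫|` by `2m`-norms. -/
def evenNorm (T : Finset V) (m : ℕ) (x : V) : ℝ :=
  (∑ v ∈ T, ⟪v, x⟫ ^ (2 * m)) ^ (1 / (2 * m : ℝ))

theorem evenNorm_eq (T : Finset V) (m : ℕ) (x : V) :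
    evenNorm T m x = (∑ v ∈ T, |⟪v, x⟫| ^ (2 * m : ℝ)) ^ (1 / (2 * m : ℝ)) := by
  unfold evenNorm
  congr 1
  refine Finset.sum_congr rfl fun v _ => ?_
  rw [← Even.pow_abs (even_two_mul m), ← Real.rpow_natCast]
  push_cast
  rfl

theorem evenNorm_neg (T : Finset V) (m : ℕ) (x : V) : evenNorm T m (-x) = evenNorm T m x := by
  simp only [evenNorm, inner_neg_right, Even.neg_pow (even_two_mul m)]

theorem sum_inner_pow_nonneg (T : Finset V) (m : ℕ) (x : V) :
    0 ≤ ∑ v ∈ T, ⟪v, x⟫ ^ (2 * m) :=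
  Finset.sum_nonneg fun _ _ => Even.pow_nonneg (even_two_mul m) _

theorem evenNorm_smul (T : Finset V) {m : ℕ} (hm : 1 ≤ m) {t : ℝ} (ht : 0 < t) (x : V) :
    evenNorm T m (t • x) = t * evenNorm T m x := by
  have hm' : (0 : ℝ) < m := by exact_mod_cast hm
  simp only [evenNorm, real_inner_smul_right, mul_pow]
  rw [← Finset.mul_sum, Real.mul_rpow (by positivity) (sum_inner_pow_nonneg T m x)]
  congr 1
  rw [← Real.rpow_natCast, ← Real.rpow_mul ht.le]
  push_cast
  rw [mul_one_div_cancel (by positivity), Real.rpow_one]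

theorem evenNorm_add_le (T : Finset V) {m : ℕ} (hm : 1 ≤ m) (x y : V) :
    evenNorm T m (x + y) ≤ evenNorm T m x + evenNorm T m y := by
  have hm' : (1 : ℝ) ≤ m := by exact_mod_cast hm
  simp only [evenNorm_eq, inner_add_right]
  exact Real.Lp_add_le T _ _ (by linarith)

theorem le_evenNorm {T : Finset V} {m : ℕ} (hm : 1 ≤ m) {v : V} (hv : v ∈ T) (x : V) :
    |⟪v, x⟫| ≤ evenNorm T m x := by
  have hm' : (0 : ℝ) < m := by exact_mod_cast hm
  rw [evenNorm_eq]
  refine (Real.le_rpow_inv_iff_of_pos (abs_nonneg _) ?_ (by positivity : (0 : ℝ) < 2 * m)).2 ?_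
    |>.trans_eq (by rw [one_div])
  · positivity
  · exact Finset.single_le_sum (f := fun v => |⟪v, x⟫| ^ (2 * m : ℝ))
      (fun _ _ => by positivity) hv

theorem evenNorm_le {T : Finset V} {m : ℕ} (hm : 1 ≤ m) {x : V} {c : ℝ} (hc : 0 ≤ c)
    (h : ∀ v ∈ T, |⟪v, x⟫| ≤ c) :
    evenNorm T m x ≤ (T.card : ℝ) ^ (1 / (2 * m : ℝ)) * c := by
  have hm' : (0 : ℝ) < m := by exact_mod_cast hm
  have hsum : ∑ v ∈ T, |⟪v, x⟫| ^ (2 * m : ℝ) ≤ T.card * c ^ (2 * m : ℝ) := by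
    rw [← nsmul_eq_mul]
    exact Finset.sum_le_card_nsmul _ _ _ fun v hv => by
      have := h v hv
      gcongr
  rw [evenNorm_eq]
  calc _ ≤ (T.card * c ^ (2 * m : ℝ)) ^ (1 / (2 * m : ℝ)) := by gcongr
    _ = _ := by
      rw [Real.mul_rpow (by positivity) (by positivity), ← Real.rpow_mul hc,
        mul_one_div_cancel (by positivity), Real.rpow_one]

theorem contDiffAt_evenNorm {T : Finset V} {m : ℕ} {x v : V} (hv : v ∈ T) (hvx : ⟪v, x⟫ ≠ 0) :
    ContDiffAt ℝ ∞ (evenNorm T m) x := by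
  refine ContDiffAt.rpow_const_of_ne
    (ContDiffAt.sum fun i _ => (contDiffAt_const.inner ℝ contDiffAt_id).pow _) (ne_of_gt ?_)
  exact Finset.sum_pos' (fun _ _ => Even.pow_nonneg (even_two_mul m) _)
    ⟨v, hv, (even_two_mul m).pow_pos hvx⟩

theorem IsSupp.neg {K : ConvexBody V} {h : V → ℝ} (hK : IsSupp K h) (hsymm : ∀ y ∈ K, -y ∈ K)
    (x : V) : h (-x) = h x := by
  have : ∀ x, h (-x) ≤ h x := fun x => by
    obtain ⟨y, hy, hxy⟩ := hK.attained (-x)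
    have := hK.le (-y) (hsymm y hy) x
    rw [inner_neg_right] at this
    rw [inner_neg_left] at hxy
    linarith
  exact le_antisymm (this x) (by simpa using this (-x))

theorem IsSegmentClass.mem_of_le_supp [FiniteDimensional ℝ V] (hZ : IsSegmentClass Z)
    {S : ConvexBody V} {h : V → ℝ} (hS : IsSupp S h) (heven : ∀ x, h (-x) = h x) {r : ℝ}
    (hr : 0 < r) (hle : ∀ x, r * ‖x‖ ≤ h x) : S ∈ Z := by
  obtain ⟨R, hR0, hR⟩ := S.isBounded.exists_pos_norm_le
  have hhR : ∀ x, h x ≤ R * ‖x‖ := fun x => by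
    obtain ⟨y, hy, hxy⟩ := hS.attained x
    have := real_inner_le_norm x y
    have := hR y hy
    nlinarith [norm_nonneg x]
  have habs : ∀ v ∈ S, ∀ x, |⟪v, x⟫| ≤ h x := fun v hv x => by
    have h1 := hS.le v hv x
    have h2 := hS.le v hv (-x)
    rw [inner_neg_left, heven] at h2
    rw [real_inner_comm] at h1 h2
    exact abs_le.2 ⟨by linarith, h1⟩
  refine Metric.mem_of_closed' hZ.isClosed |>.2 fun ε hε => ?_
  obtain ⟨T, hTS, hTf, hT⟩ := S.isCompact.finite_cover_balls
    (e := min (ε / 2) (r / 2)) (by positivity)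
  lift T to Finset V using hTf
  have hnet : ∀ x, ∃ v ∈ T, h x - min (ε / 2) (r / 2) * ‖x‖ ≤ ⟪v, x⟫ := fun x => by
    obtain ⟨y, hy, hxy⟩ := hS.attained x
    obtain ⟨v, hv, hyv⟩ := Set.mem_iUnion₂.1 (hT hy)
    refine ⟨v, hv, ?_⟩
    have h1 := real_inner_le_norm x (y - v)
    rw [inner_sub_right, hxy, real_inner_comm] at h1
    rw [Metric.mem_ball, dist_eq_norm] at hyv
    nlinarith [norm_nonneg x]
  have hlim : Filter.Tendsto (fun m : ℕ => (T.card : ℝ) ^ (1 / (2 * m : ℝ))) Filter.atTop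
      (nhds 1) := by
    have hT0 : (T.card : ℝ) ≠ 0 := by
      obtain ⟨v, hv, -⟩ := hnet 0
      exact_mod_cast (Finset.card_pos.2 ⟨v, hv⟩).ne'
    have h1 : Filter.Tendsto (fun m : ℕ => 1 / (2 * m : ℝ)) Filter.atTop (nhds 0) :=
      (tendsto_natCast_atTop_atTop.const_mul_atTop two_pos).const_div_atTop 1
    have h2 := (Real.continuousAt_const_rpow hT0).tendsto.comp h1
    rw [Real.rpow_zero] at h2
    exact h2
  obtain ⟨m, hm, hm1⟩ := ((hlim.eventually (gt_mem_nhds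
    (by linarith [div_pos hε (mul_pos two_pos hR0)] : (1 : ℝ) < 1 + ε / (2 * R)))).and
    (Filter.eventually_ge_atTop 1)).exists
  have hup : ∀ x, evenNorm T m x ≤ h x + ε / 2 * ‖x‖ := fun x => by
    have hx : 0 ≤ h x := (by positivity : 0 ≤ r * ‖x‖).trans (hle x)
    calc _ ≤ _ := evenNorm_le hm1 hx fun v hv => habs v (hTS hv) x
      _ ≤ (1 + ε / (2 * R)) * h x := by gcongr
      _ = h x + ε / (2 * R) * h x := by ring
      _ ≤ h x + ε / (2 * R) * (R * ‖x‖) := by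
        have := hhR x
        gcongr
      _ = _ := by field_simp
  have hlow : ∀ x, h x - ε / 2 * ‖x‖ ≤ evenNorm T m x := fun x => by
    obtain ⟨v, hv, hvx⟩ := hnet x
    have := (le_abs_self _).trans (le_evenNorm hm1 hv x)
    have := min_le_left (ε / 2) (r / 2)
    nlinarith [norm_nonneg x]
  obtain ⟨K, hK⟩ := exists_of_sublinear (fun t ht x => evenNorm_smul T hm1 ht x)
    (evenNorm_add_le T hm1) (C := R + ε / 2) fun x => by linarith [hup x, hhR x]
  refine ⟨K, hZ.mem_of_smooth hK (fun x hx => ?_) (evenNorm_neg T m), ?_⟩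
  · obtain ⟨v, hv, hvx⟩ := hnet x
    refine contDiffAt_evenNorm hv (ne_of_gt ?_)
    have := min_le_right (ε / 2) (r / 2)
    have := hle x
    nlinarith [norm_pos_iff.2 hx]
  · refine (hS.dist_le hK (by positivity : 0 ≤ ε / 2) fun x => ?_).trans_lt (by linarith)
    exact abs_le.2 ⟨by linarith [hup x], by linarith [hlow x]⟩

/-- A class of convex bodies as in `IsSegmentClass` contains all centrally symmetric bodies. -/
theorem IsSegmentClass.mem_of_symm [FiniteDimensional ℝ V] (hZ : IsSegmentClass Z)
    {S : ConvexBody V} (hsymm : ∀ y ∈ S, -y ∈ S) : S ∈ Z := by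
  obtain ⟨B, hB⟩ := exists_of_sublinear (V := V) (h := fun x => ‖x‖)
    (fun t ht x => by rw [norm_smul, Real.norm_eq_abs, abs_of_pos ht]) norm_add_le (C := 1)
    (fun x => by rw [one_mul])
  obtain ⟨h, hS⟩ := exists_isSupp S
  have h0 : ∀ x, 0 ≤ h x := fun x => by
    obtain ⟨y, hy⟩ := S.nonempty
    have h1 := hS.le y hy x
    have h2 := hS.le (-y) (hsymm y hy) x
    rw [inner_neg_right] at h2
    linarith
  refine hZ.cancel S B (hZ.mem_of_le_supp hB (fun x => norm_neg x) one_pos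
    fun x => by rw [one_mul]) (hZ.mem_of_le_supp (hS.add hB) (fun x => ?_) one_pos fun x => ?_)
  · simp [hS.neg hsymm]
  · simp [h0 x]

end ConvexBody

open ConvexBody

/-- A continuous translation invariant functional which does not change when a segment is added
vanishes on centrally symmetric bodies, provided it vanishes on points. -/
theorem eq_zero_of_symm [FiniteDimensional ℝ V] {φ : ConvexBody V → ℝ} (hcont : Continuous φ)
    (htrans : TransInv φ) (hincr : ∀ v K, φ (K + seg 0 v) = φ K) (h0 : φ 0 = 0)
    {S : ConvexBody V} (hsymm : ∀ y ∈ S, -y ∈ S) : φ S = 0 := by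
  have hZ : IsSegmentClass {Z : ConvexBody V | ∀ K, φ (K + Z) = φ K} :=
    { isClosed := by
        simp only [Set.ofPred_forall]
        exact isClosed_iInter fun K =>
          isClosed_eq (hcont.comp (continuous_add_left K)) continuous_const
      zero_mem := fun K => by rw [add_zero]
      add_mem := fun K hK L hL M => by rw [← add_assoc, hL, hK]
      seg_mem := fun v K => by
        have : seg (-v) v = seg 0 ((2 : ℝ) • v) + point (-v) := by
          rw [seg_add_point]
          congr 1 <;> module
        rw [this, ← add_assoc, htrans.add_point, hincr]
      cancel := fun K L hL hKL M => by
        rw [← hL (M + K), add_assoc, hKL] }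
  have := hZ.mem_of_symm hsymm 0
  rwa [zero_add, h0] at this

end Symmetric

section Cones

open ConvexBody

variable {V : Type*} [NormedAddCommGroup V] [NormedSpace ℝ V]

open Classical in
/-- Extension by zero of a functional on convex bodies to all sets. -/
def setFun (μ : ConvexBody V → ℝ) (s : Set V) : ℝ :=
  if h : Convex ℝ s ∧ IsCompact s ∧ s.Nonempty then μ ⟨s, h.1, h.2.1, h.2.2⟩ else 0

theorem setFun_coe (μ : ConvexBody V → ℝ) (K : ConvexBody V) : setFun μ K = μ K :=
  dif_pos ⟨K.convex, K.isCompact, K.nonempty⟩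

@[simp] theorem setFun_empty (μ : ConvexBody V → ℝ) : setFun μ ∅ = 0 :=
  dif_neg fun h => Set.not_nonempty_empty h.2.2

theorem setFun_eq_zero {μ : ConvexBody V → ℝ} {s : Set V}
    (h : ∀ K : ConvexBody V, (K : Set V) = s → μ K = 0) : setFun μ s = 0 := by
  unfold setFun
  split_ifs
  · exact h _ rfl
  · rfl

theorem setFun_union {μ : ConvexBody V → ℝ} (hval : IsValuation μ) {s t : Set V}
    (hs : Convex ℝ s) (hsc : IsCompact s) (ht : Convex ℝ t) (htc : IsCompact t)
    (hst : Convex ℝ (s ∪ t)) :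
    setFun μ (s ∪ t) + setFun μ (s ∩ t) = setFun μ s + setFun μ t := by
  rcases s.eq_empty_or_nonempty with rfl | hsn
  · simp
  rcases t.eq_empty_or_nonempty with rfl | htn
  · simp
  have hne : (s ∩ t).Nonempty := by
    obtain ⟨x, -, hx⟩ := isPreconnected_closed_iff.1 hst.isPreconnected s t hsc.isClosed
      htc.isClosed subset_rfl (by simpa [Set.union_inter_cancel_left] using hsn)
      (by simpa [Set.union_inter_cancel_right] using htn)
    exact ⟨x, hx⟩
  have := hval ⟨s, hs, hsc, hsn⟩ ⟨t, ht, htc, htn⟩ ⟨s ∪ t, hst, hsc.union htc, hsn.inl⟩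
    ⟨s ∩ t, hs.inter ht, hsc.inter htc, hne⟩ rfl rfl
  simp only [← setFun_coe μ] at this
  exact this

theorem setFun_reflect {μ : ConvexBody V → ℝ} (htrans : TransInv μ) (heven : EvenVal μ)
    {s : Set V} (hs : Convex ℝ s) (hsc : IsCompact s) (a : V) :
    setFun μ {x | a - x ∈ s} = setFun μ s := by
  rcases s.eq_empty_or_nonempty with rfl | hsn
  · simp
  let K : ConvexBody V := ⟨s, hs, hsc, hsn⟩
  have : {x | a - x ∈ s} = (K.reflect.translate a : Set V) := by
    ext x
    change _ ↔ x ∈ -s + {a}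
    rw [Set.add_singleton, Set.mem_image, Set.mem_ofPred_eq]
    constructor
    · exact fun h => ⟨x - a, by simpa using h, by abel⟩
    · rintro ⟨y, hy, rfl⟩
      simpa using hy
  rw [this, setFun_coe, htrans, heven, ← setFun_coe μ K]
  rfl

/-- The properties of a valuation used in the cone argument. -/
structure IsSimpleEven (μ : ConvexBody V → ℝ) : Prop where
  val : IsValuation μ
  trans : TransInv μ
  even : EvenVal μ
  simple : ∀ K : ConvexBody V, interior (K : Set V) = ∅ → μ K = 0
  symm : ∀ K : ConvexBody V, (∀ y ∈ K, -y ∈ K) → μ K = 0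

namespace IsSimpleEven

variable {μ : ConvexBody V → ℝ} (hμ : IsSimpleEven μ)

include hμ

theorem setFun_eq_zero_of_interior {s : Set V} (hs : interior s = ∅) : setFun μ s = 0 :=
  setFun_eq_zero fun K hK => hμ.simple K (hK ▸ hs)

theorem setFun_eq_zero_of_symm {s : Set V} (a : V) (hs : ∀ y ∈ s, a - y ∈ s) :
    setFun μ s = 0 := by
  refine setFun_eq_zero fun K hK => ?_
  rw [← hμ.trans K (-((1 / 2 : ℝ) • a))]
  refine hμ.symm _ ?_
  rintro _ ⟨y, hy, z, hz, rfl⟩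
  obtain rfl : z = _ := hz
  refine ⟨a - y, ?_, _, rfl, ?_⟩
  · rw [hK] at hy ⊢
    exact hs y hy
  · dsimp only
    module

theorem setFun_cut {s : Set V} (hs : Convex ℝ s) (hsc : IsCompact s) {f : V →L[ℝ] ℝ}
    (hf : f ≠ 0) (c : ℝ) :
    setFun μ s = setFun μ (s ∩ {x | f x ≤ c}) + setFun μ (s ∩ {x | c ≤ f x}) := by
  have h1 : Convex ℝ {x | f x ≤ c} := convex_halfSpace_le f.isLinear c
  have h2 : Convex ℝ {x | c ≤ f x} := convex_halfSpace_ge f.isLinear c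
  have hu : s ∩ {x | f x ≤ c} ∪ s ∩ {x | c ≤ f x} = s := by
    ext x
    have := le_total (f x) c
    simp only [Set.mem_union, Set.mem_inter_iff, Set.mem_ofPred_eq]
    tauto
  have hi : interior (s ∩ {x | f x ≤ c} ∩ (s ∩ {x | c ≤ f x})) = ∅ := by
    have hsub : s ∩ {x | f x ≤ c} ∩ (s ∩ {x | c ≤ f x}) ⊆ f ⁻¹' {c} :=
      fun x hx => le_antisymm hx.1.2 hx.2.2
    refine Set.subset_empty_iff.1 ((interior_mono hsub).trans ?_)
    rw [← (f.isOpenMap_of_ne_zero hf).preimage_interior_eq_interior_preimage f.continuous]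
    simp
  have := setFun_union hμ.val (hs.inter h1)
    (hsc.inter_right (isClosed_le f.continuous continuous_const)) (hs.inter h2)
    (hsc.inter_right (isClosed_le continuous_const f.continuous)) (by rwa [hu])
  rw [hu, hμ.setFun_eq_zero_of_interior hi] at this
  linarith

/-- A simple even valuation vanishing on symmetric bodies vanishes on truncated cones. -/
theorem setFun_cone [Nontrivial V] {C : Set V} (hC : Convex ℝ C) (hCc : IsClosed C)
    (hCs : ∀ x ∈ C, ∀ t : ℝ, 0 ≤ t → t • x ∈ C) {u : V →L[ℝ] ℝ}
    (hQc : IsCompact (C ∩ {x | u x ≤ 1})) : setFun μ (C ∩ {x | u x ≤ 1}) = 0 := by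
  rcases (interior C).eq_empty_or_nonempty with hint | hint
  · exact hμ.setFun_eq_zero_of_interior
      (Set.subset_empty_iff.1 ((interior_mono Set.inter_subset_left).trans hint.subset))
  obtain ⟨R, hR0, hR⟩ := hQc.isBounded.exists_pos_norm_le
  have hpos : ∀ x ∈ C, x ≠ 0 → 0 < u x := by
    intro x hx hx0
    by_contra! hux
    have hxn := norm_pos_iff.2 hx0
    have h1 := hR ((2 * R / ‖x‖) • x) ⟨hCs x hx _ (by positivity), by
      simp only [Set.mem_ofPred_eq, map_smul, smul_eq_mul]
      have : 0 < 2 * R / ‖x‖ := by positivity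
      nlinarith⟩
    rw [norm_smul, Real.norm_eq_abs, abs_of_pos (by positivity), div_mul_cancel₀ _ hxn.ne'] at h1
    linarith
  obtain ⟨a₀, ha₀, ha₀n⟩ := (dense_compl_singleton (0 : V)).inter_open_nonempty _
    isOpen_interior hint
  have hua₀ := hpos a₀ (interior_subset ha₀) ha₀n
  obtain ⟨r, hr, hball⟩ := Metric.mem_nhds_iff.1 (mem_interior_iff_mem_nhds.1 ha₀)
  set t : ℝ := 2 * R / r + 2 / u a₀ with ht
  have ht0 : 0 < t := by positivity
  set a := t • a₀ with ha
  have hua : 2 ≤ u a := by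
    rw [ha, map_smul, smul_eq_mul, ht, add_mul, div_mul_cancel₀ _ hua₀.ne']
    have : 0 < 2 * R / r * u a₀ := by positivity
    linarith
  have haQ : ∀ x ∈ C ∩ {x | u x ≤ 1}, a - x ∈ C := by
    intro x hx
    have h1 : a₀ - t⁻¹ • x ∈ C := by
      apply hball
      rw [Metric.mem_ball, dist_eq_norm, sub_sub_cancel_left, norm_neg, norm_smul, norm_inv,
        Real.norm_eq_abs, abs_of_pos ht0, inv_mul_lt_iff₀ ht0]
      have h2 := hR x hx
      have h3 : t * r = 2 * R + 2 / u a₀ * r := by rw [ht]; field_simp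
      have h4 : 0 < 2 / u a₀ * r := by positivity
      linarith
    have h2 := hCs _ h1 t ht0.le
    rwa [smul_sub, smul_smul, mul_inv_cancel₀ ht0.ne', one_smul] at h2
  have hu0 : u ≠ 0 := fun h => by simp [h] at hua₀
  set M : Set V := C ∩ {x | a - x ∈ C} with hM
  have hMconv : Convex ℝ M := hC.inter (fun x hx y hy p q hp hq hpq => by
    have : a - (p • x + q • y) = p • (a - x) + q • (a - y) := by
      calc _ = (p + q) • a - (p • x + q • y) := by rw [hpq, one_smul]
        _ = _ := by module
    rw [Set.mem_ofPred_eq, this]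
    exact hC hx hy hp hq hpq)
  have hMc : IsCompact M := by
    refine (hQc.smul (u a)).of_isClosed_subset
      (hCc.inter (hCc.preimage (by fun_prop))) fun x hx => ?_
    have hua0 : 0 < u a := by linarith
    refine ⟨(u a)⁻¹ • x, ⟨hCs x hx.1 _ (by positivity), ?_⟩, ?_⟩
    · have h1 : 0 ≤ u (a - x) := by
        rcases eq_or_ne (a - x) 0 with h | h
        · simp [h]
        · exact (hpos _ hx.2 h).le
      rw [map_sub] at h1
      rw [Set.mem_ofPred_eq, map_smul, smul_eq_mul, inv_mul_le_iff₀ hua0]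
      linarith
    · simp [smul_smul, hua0.ne']
  have hM0 : setFun μ M = 0 := hμ.setFun_eq_zero_of_symm a fun y hy =>
    ⟨hy.2, by simpa using hy.1⟩
  have hMle : M ∩ {x | u x ≤ 1} = C ∩ {x | u x ≤ 1} := by
    ext x
    exact ⟨fun h => ⟨h.1.1, h.2⟩, fun h => ⟨⟨h.1, haQ x h⟩, h.2⟩⟩
  have hcut := hμ.setFun_cut hMconv hMc hu0 1
  have hcut' := hμ.setFun_cut (s := M ∩ {x | 1 ≤ u x})
    (hMconv.inter (convex_halfSpace_ge u.isLinear 1))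
    (hMc.inter_right (isClosed_le continuous_const u.continuous)) hu0 (u a - 1)
  have hmid : setFun μ (M ∩ {x | 1 ≤ u x} ∩ {x | u x ≤ u a - 1}) = 0 := by
    refine hμ.setFun_eq_zero_of_symm a fun y hy => ?_
    obtain ⟨⟨⟨h1, h2⟩, h3⟩, h4⟩ := hy
    simp only [Set.mem_ofPred_eq] at h3 h4
    refine ⟨⟨⟨h2, by simpa using h1⟩, ?_⟩, ?_⟩ <;>
      simp only [Set.mem_ofPred_eq, map_sub] <;> linarith
  have hlast : M ∩ {x | 1 ≤ u x} ∩ {x | u a - 1 ≤ u x} = {x | a - x ∈ C ∩ {x | u x ≤ 1}} := by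
    ext x
    constructor
    · rintro ⟨⟨⟨h1, h2⟩, h3⟩, h4⟩
      refine ⟨h2, ?_⟩
      simp only [Set.mem_ofPred_eq, map_sub] at h4 ⊢
      linarith
    · rintro h
      have h1 := haQ _ h
      obtain ⟨h2, h3⟩ := h
      simp only [Set.mem_ofPred_eq, map_sub] at h3
      rw [sub_sub_cancel] at h1
      refine ⟨⟨⟨h1, h2⟩, ?_⟩, ?_⟩ <;> simp only [Set.mem_ofPred_eq] <;> linarith
  have hQ : Convex ℝ (C ∩ {x | u x ≤ 1}) := hC.inter (convex_halfSpace_le u.isLinear 1)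
  rw [hM0, hMle, hcut', hmid, hlast, setFun_reflect hμ.trans hμ.even hQ hQc] at hcut
  linarith

/-- Subdividing a cone along finitely many hyperplanes. -/
theorem setFun_inter_cone {P : Set V} (hP : Convex ℝ P) (hPc : IsCompact P)
    (L : List (V →L[ℝ] ℝ)) : ∀ C : Set V, Convex ℝ C → IsClosed C →
      (∀ x ∈ C, ∀ t : ℝ, 0 ≤ t → t • x ∈ C) →
      (∀ D ⊆ C, Convex ℝ D → IsClosed D → (∀ x ∈ D, ∀ t : ℝ, 0 ≤ t → t • x ∈ D) →
        (∀ f ∈ L, (∀ x ∈ D, f x ≤ 0) ∨ ∀ x ∈ D, 0 ≤ f x) → setFun μ (P ∩ D) = 0) →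
      setFun μ (P ∩ C) = 0 := by
  induction L with
  | nil => exact fun C hC hCc hCs h => h C subset_rfl hC hCc hCs (by simp)
  | cons f L ih =>
    intro C hC hCc hCs h
    rcases eq_or_ne f 0 with rfl | hf
    · refine ih C hC hCc hCs fun D hDC hD hDc hDs hL => h D hDC hD hDc hDs ?_
      simpa using hL
    · have h1 : Convex ℝ {x | f x ≤ 0} := convex_halfSpace_le f.isLinear 0
      have h2 : Convex ℝ {x | 0 ≤ f x} := convex_halfSpace_ge f.isLinear 0
      rw [hμ.setFun_cut (hP.inter hC) (hPc.inter_right hCc) hf 0, Set.inter_assoc,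
        Set.inter_assoc, ih (C ∩ {x | f x ≤ 0}), ih (C ∩ {x | 0 ≤ f x}), add_zero]
      · exact hC.inter h2
      · exact hCc.inter (isClosed_le continuous_const f.continuous)
      · exact fun x hx t ht => ⟨hCs x hx.1 t ht, by simpa using mul_nonneg ht hx.2⟩
      · intro D hDC hD hDc hDs hL
        refine h D (hDC.trans Set.inter_subset_left) hD hDc hDs ?_
        simpa using ⟨Or.inr fun x hx => (hDC hx).2, hL⟩
      · exact hC.inter h1
      · exact hCc.inter (isClosed_le f.continuous continuous_const)
      · exact fun x hx t ht => ⟨hCs x hx.1 t ht, by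
          simpa using mul_nonpos_of_nonneg_of_nonpos ht hx.2⟩
      · intro D hDC hD hDc hDs hL
        refine h D (hDC.trans Set.inter_subset_left) hD hDc hDs ?_
        simpa using ⟨Or.inl fun x hx => (hDC hx).2, hL⟩

theorem setFun_polytope [Nontrivial V] {T : Finset (V →L[ℝ] ℝ)} (hT : T.Nonempty)
    (hPc : IsCompact {x | ∀ u ∈ T, u x ≤ 1}) : setFun μ {x | ∀ u ∈ T, u x ≤ 1} = 0 := by
  set P : Set V := {x | ∀ u ∈ T, u x ≤ 1} with hPdef
  have hP : Convex ℝ P := by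
    have : P = ⋂ u ∈ T, {x | u x ≤ 1} := by ext; simp [hPdef]
    rw [this]
    exact convex_iInter₂ fun u _ => convex_halfSpace_le u.isLinear 1
  rw [← Set.inter_univ P]
  refine hμ.setFun_inter_cone hP hPc ((T ×ˢ T).toList.map fun p => p.1 - p.2) _ convex_univ
    isClosed_univ (fun _ _ _ _ => Set.mem_univ _) fun D _ hD hDc hDs hsign => ?_
  have hcomp : ∀ u ∈ T, ∀ v ∈ T, (∀ x ∈ D, u x ≤ v x) ∨ ∀ x ∈ D, v x ≤ u x := by
    intro u hu v hv
    simpa using hsign (u - v) (List.mem_map.2 ⟨(u, v), by simp [hu, hv], rfl⟩)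
  have hmax : ∀ S : Finset (V →L[ℝ] ℝ), S.Nonempty → S ⊆ T →
      ∃ u ∈ S, ∀ v ∈ S, ∀ x ∈ D, v x ≤ u x := by
    intro S hS
    induction hS using Finset.Nonempty.cons_induction with
    | singleton u => exact fun _ => ⟨u, by simp, by simp⟩
    | cons v S hv hS ih =>
      intro hST
      obtain ⟨u, hu, hmax⟩ := ih ((Finset.subset_cons hv).trans hST)
      rcases hcomp u (hST (Finset.mem_cons_of_mem hu)) v (hST (Finset.mem_cons_self v S))
        with h | h
      · refine ⟨v, Finset.mem_cons_self v S, fun w hw x hx => ?_⟩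
        rcases Finset.mem_cons.1 hw with rfl | hw
        · exact le_rfl
        · exact (hmax w hw x hx).trans (h x hx)
      · refine ⟨u, Finset.mem_cons_of_mem hu, fun w hw x hx => ?_⟩
        rcases Finset.mem_cons.1 hw with rfl | hw
        · exact h x hx
        · exact hmax w hw x hx
  obtain ⟨u, hu, hmax⟩ := hmax T hT subset_rfl
  have : P ∩ D = D ∩ {x | u x ≤ 1} := by
    ext x
    exact ⟨fun h => ⟨h.2, h.1 u hu⟩, fun h => ⟨fun v hv => (hmax v hv x h.1).trans h.2, h.1⟩⟩
  rw [this]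
  exact hμ.setFun_cone hD hDc hDs (this ▸ hPc.inter_right hDc)

end IsSimpleEven

/-- Outer approximation of a convex body by polytopes. -/
theorem exists_polytope [FiniteDimensional ℝ V] {K : ConvexBody V}
    (h0 : (0 : V) ∈ interior (K : Set V)) {ε : ℝ} (hε : 0 < ε) :
    ∃ T : Finset (V →L[ℝ] ℝ), (∀ x ∈ K, ∀ u ∈ T, u x ≤ 1) ∧
      ∀ x, (∀ u ∈ T, u x ≤ 1) → (1 + ε)⁻¹ • x ∈ K := by
  have hnhds : (K : Set V) ∈ nhds 0 := mem_interior_iff_mem_nhds.1 h0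
  have hle : ∀ x, gauge (K : Set V) x ≤ 1 ↔ x ∈ K := fun x => by
    rw [gauge_le_one_iff_mem_closure K.convex hnhds, K.isClosed.closure_eq]
    rfl
  have hε1 : 0 < 1 + ε := by linarith
  have hgs : ∀ t : ℝ, 0 ≤ t → ∀ x, gauge (K : Set V) (t • x) = t * gauge (K : Set V) x :=
    fun t ht x => by rw [gauge_smul_of_nonneg ht, smul_eq_mul]
  set F : Set V := {x | gauge (K : Set V) x = 1 + ε} with hF
  have hFc : IsCompact F := by
    refine (K.isCompact.smul (1 + ε)).of_isClosed_subset
      (isClosed_eq (continuous_gauge K.convex hnhds) continuous_const) fun x hx => ?_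
    refine ⟨(1 + ε)⁻¹ • x, ?_, by simp [smul_smul, hε1.ne']⟩
    refine (hle _).1 ?_
    rw [hgs _ (by positivity), show gauge (K : Set V) x = 1 + ε from hx, inv_mul_cancel₀ hε1.ne']
  have hsep : ∀ z ∈ F, ∃ u : V →L[ℝ] ℝ, (∀ x ∈ K, u x ≤ 1) ∧ 1 < u z := by
    intro z hz
    have hzK : z ∉ (K : Set V) := fun h => by
      have h1 := (hle z).2 h
      have h2 : gauge (K : Set V) z = 1 + ε := hz
      linarith
    obtain ⟨f, s, hs, hsz⟩ := geometric_hahn_banach_closed_point K.convex K.isClosed hzK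
    have hs0 : 0 < s := by simpa using hs 0 (interior_subset h0)
    refine ⟨s⁻¹ • f, fun x hx => ?_, ?_⟩
    · simpa using (inv_mul_le_iff₀ hs0).2 (by simpa using (hs x hx).le)
    · simpa using (lt_inv_mul_iff₀ hs0).2 (by simpa using hsz)
  choose! u huK huz using hsep
  obtain ⟨T, hTF, hT⟩ := hFc.elim_nhds_subcover (fun z => {x | 1 < u z x}) fun z hz =>
    (isOpen_lt continuous_const (u z).continuous).mem_nhds (huz z hz)
  classical
  refine ⟨T.image u, fun x hx v hv => ?_, fun x hx => ?_⟩
  · obtain ⟨z, hz, rfl⟩ := Finset.mem_image.1 hv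
    exact huK z (hTF z hz) x hx
  · refine (hle _).1 ?_
    rw [hgs _ (by positivity), inv_mul_le_iff₀ hε1, mul_one]
    by_contra! hgx
    set g := gauge (K : Set V) x
    have hg0 : 0 < g := hε1.trans hgx
    have hz : ((1 + ε) / g) • x ∈ F := by
      change gauge (K : Set V) _ = _
      rw [hgs _ (by positivity)]
      exact div_mul_cancel₀ _ hg0.ne'
    obtain ⟨z, hzT, hz1⟩ := Set.mem_iUnion₂.1 (hT hz)
    have h1 := hx (u z) (Finset.mem_image_of_mem _ hzT)
    have h2 : 1 < (1 + ε) / g * u z x := by simpa using hz1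
    have h3 : (1 + ε) / g < 1 := (div_lt_one hg0).2 hgx
    have h4 : 0 < (1 + ε) / g := by positivity
    nlinarith

theorem IsSimpleEven.eq_zero [FiniteDimensional ℝ V] [Nontrivial V] {μ : ConvexBody V → ℝ}
    (hμ : IsSimpleEven μ) (hcont : Continuous μ) (K : ConvexBody V) : μ K = 0 := by
  rcases (interior (K : Set V)).eq_empty_or_nonempty with hint | ⟨p, hp⟩
  · exact hμ.simple K hint
  wlog h0 : p = 0 generalizing K p
  · rw [← hμ.trans K (-p)]
    refine this _ 0 ?_ rfl
    have : ((K.translate (-p) : ConvexBody V) : Set V) = Homeomorph.addRight (-p) '' K :=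
      Set.add_singleton
    rw [this, ← Homeomorph.image_interior]
    exact ⟨p, hp, by simp⟩
  subst h0
  obtain ⟨R, hR0, hR⟩ := K.isBounded.exists_pos_norm_le
  refine (Metric.mem_of_closed' (isClosed_eq hcont continuous_const : IsClosed {K | μ K = 0})).2
    fun ε hε => ?_
  set δ := ε / (2 * R) with hδ
  have hδ0 : 0 < δ := by positivity
  obtain ⟨T, hKT, hTK⟩ := exists_polytope hp hδ0
  classical
  let P : Set V := {x | ∀ u ∈ insert 0 T, u x ≤ 1}
  have hPK : ∀ x ∈ P, (1 + δ)⁻¹ • x ∈ K := fun x hx =>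
    hTK x fun u hu => hx u (Finset.mem_insert_of_mem hu)
  have hKP : (K : Set V) ⊆ P := fun x hx u hu => by
    rcases Finset.mem_insert.1 hu with rfl | hu
    · simp
    · exact hKT x hx u hu
  have hPinter : P = ⋂ u ∈ insert 0 T, {x | u x ≤ 1} := by
    ext
    simp [P]
  have hPconv : Convex ℝ P := by
    rw [hPinter]
    exact convex_iInter₂ fun u _ => convex_halfSpace_le u.isLinear 1
  have hPc : IsCompact P := by
    refine (K.isCompact.smul (1 + δ)).of_isClosed_subset ?_ fun x hx =>
      ⟨_, hPK x hx, by simp [smul_smul, (by positivity : 1 + δ ≠ 0)]⟩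
    rw [hPinter]
    exact isClosed_biInter fun u _ => isClosed_le u.continuous continuous_const
  have hP0 : setFun μ P = 0 := hμ.setFun_polytope (Finset.insert_nonempty _ _) hPc
  let Q : ConvexBody V := ⟨P, hPconv, hPc, K.nonempty.mono hKP⟩
  refine ⟨Q, (setFun_coe μ Q).symm.trans hP0, ?_⟩
  refine (dist_le_of (by positivity : 0 ≤ δ * R)
    (fun x hx => ⟨x, hKP hx, by rw [dist_self]; positivity⟩)
    fun x hx => ⟨_, hPK x hx, ?_⟩).trans_lt ?_
  · have h1 := hR _ (hPK x hx)
    have h2 : x - (1 + δ)⁻¹ • x = δ • (1 + δ)⁻¹ • x := by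
      have : (1 + δ) ≠ 0 := by positivity
      calc _ = ((1 + δ) * (1 + δ)⁻¹) • x - (1 + δ)⁻¹ • x := by
            rw [mul_inv_cancel₀ this, one_smul]
        _ = _ := by module
    rw [dist_eq_norm, h2, norm_smul, Real.norm_eq_abs, abs_of_pos hδ0]
    gcongr
  · rw [hδ]
    field_simp
    linarith

end Cones

section Klain

open ConvexBody

namespace ConvexBody

variable {V W : Type*} [NormedAddCommGroup V] [NormedSpace ℝ V] [NormedAddCommGroup W]
  [NormedSpace ℝ W]

/-- The image of a convex body under a linear isometry. -/
def mapIso (f : W →ₗᵢ[ℝ] V) (K : ConvexBody W) : ConvexBody V :=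
  ⟨f '' K, K.convex.linear_image f.toLinearMap, K.isCompact.image f.continuous,
    K.nonempty.image f⟩

theorem coe_mapIso (f : W →ₗᵢ[ℝ] V) (K : ConvexBody W) : (mapIso f K : Set V) = f '' K := rfl

theorem continuous_mapIso (f : W →ₗᵢ[ℝ] V) : Continuous (mapIso f) :=
  Isometry.continuous (Isometry.of_dist_eq fun _ _ => Metric.hausdorffDist_image f.isometry)

theorem mapIso_translate (f : W →ₗᵢ[ℝ] V) (K : ConvexBody W) (x : W) :
    mapIso f (K.translate x) = (mapIso f K).translate (f x) := by
  apply ConvexBody.ext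
  change f '' (K + {x}) = f '' K + {f x}
  rw [Set.image_add, Set.image_singleton]

theorem mapIso_reflect (f : W →ₗᵢ[ℝ] V) (K : ConvexBody W) :
    mapIso f K.reflect = (mapIso f K).reflect := by
  apply ConvexBody.ext
  change f '' (-K) = -(f '' K)
  exact Set.image_neg f (K : Set W)

theorem reflect_add (K L : ConvexBody V) : (K + L).reflect = K.reflect + L.reflect := by
  apply ConvexBody.ext
  change -((K : Set V) + L) = -K + -L
  rw [neg_add]

theorem reflect_seg (v : V) : (seg 0 v).reflect = seg 0 v + point (-v) := by
  rw [seg_add_point]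
  apply ConvexBody.ext
  change -(segment ℝ 0 v) = segment ℝ (0 + -v) (v + -v)
  rw [zero_add, add_neg_cancel, segment_symm ℝ (-v)]
  simpa using image_segment ℝ (-LinearMap.id : V →ₗ[ℝ] V).toAffineMap 0 v

theorem smul_seg (c : ℝ) (v : V) : c • seg 0 v = seg 0 (c • v) := by
  apply ConvexBody.ext
  change c • segment ℝ 0 v = segment ℝ 0 (c • v)
  have h : segment ℝ 0 (c • v) = segment ℝ (c • 0) (c • v) := by rw [smul_zero]
  rw [h]
  exact image_segment ℝ (LinearMap.lsmul ℝ V c).toAffineMap 0 v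

end ConvexBody

variable {V : Type*} [NormedAddCommGroup V] [NormedSpace ℝ V]

theorem IsValuation.mapIso {W : Type*} [NormedAddCommGroup W] [NormedSpace ℝ W]
    {φ : ConvexBody V → ℝ} (h : IsValuation φ) (f : W →ₗᵢ[ℝ] V) :
    IsValuation fun K => φ (mapIso f K) := by
  intro K L M I hM hI
  apply h
  · simp only [coe_mapIso, hM, Set.image_union]
  · simp only [coe_mapIso, hI, Set.image_inter f.injective]

/-- The properties of valuations which are stable in the induction on the degree. -/
structure IsEvenVal (φ : ConvexBody V → ℝ) : Prop where
  val : IsValuation φ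
  cont : Continuous φ
  trans : TransInv φ
  even : EvenVal φ

namespace IsEvenVal

variable {φ : ConvexBody V → ℝ} (hφ : IsEvenVal φ)

include hφ

theorem segIncr (v : V) : IsEvenVal (segIncr φ v) where
  val K L M I hM hI := by
    have h1 := hφ.val.add_right (seg 0 v) K L M I hM hI
    have h2 := hφ.val K L M I hM hI
    simp only [_root_.segIncr] at h1 ⊢
    linarith
  cont := (hφ.cont.comp (continuous_add_right (seg 0 v))).sub hφ.cont
  trans K x := by
    have h := hφ.trans.add_point (K + seg 0 v) x
    simp only [_root_.segIncr]
    rw [translate_eq, add_right_comm, h, hφ.trans.add_point]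
  even K := by
    have h : φ (K.reflect + seg 0 v) = φ (K + seg 0 v) := by
      rw [← hφ.even (K + seg 0 v), reflect_add, reflect_seg, ← add_assoc, hφ.trans.add_point]
    simp only [_root_.segIncr]
    rw [h, hφ.even]

theorem segIncr_homog {k : ℕ}
    (hhom : ∀ m : ℕ, 0 < m → ∀ K, φ ((m : ℝ) • K) = (m : ℝ) ^ (k + 1) * φ K) (v : V) (m : ℕ)
    (hm : 0 < m) (K : ConvexBody V) :
    _root_.segIncr φ v ((m : ℝ) • K) = (m : ℝ) ^ k * _root_.segIncr φ v K := by
  have hm0 : (m : ℝ) ≠ 0 := by positivity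
  have hv : (m : ℝ) • (m : ℝ)⁻¹ • v = v := smul_inv_smul₀ hm0 v
  have h1 := segIncr_nat_smul hφ.val hφ.trans ((m : ℝ)⁻¹ • v) K m
  have h2 : (m : ℝ) • K + seg 0 v = (m : ℝ) • (K + seg 0 ((m : ℝ)⁻¹ • v)) := by
    rw [smul_add, smul_seg, hv]
  rw [hv] at h1
  rw [h1]
  simp only [_root_.segIncr]
  rw [h2, hhom m hm, hhom m hm]
  ring

end IsEvenVal

section Inner

variable {V : Type*} [NormedAddCommGroup V] [InnerProductSpace ℝ V] [FiniteDimensional ℝ V]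

/-- If an even valuation vanishes on symmetric bodies, it vanishes identically. -/
theorem IsEvenVal.eq_zero_of_symm {φ : ConvexBody V → ℝ} (hφ : IsEvenVal φ)
    (hsymm : ∀ S : ConvexBody V, (∀ y ∈ S, -y ∈ S) → φ S = 0) (K : ConvexBody V) : φ K = 0 := by
  suffices H : ∀ d : ℕ, ∀ E : Submodule ℝ V, Module.finrank ℝ E ≤ d →
      ∀ K : ConvexBody V, (K : Set V) ⊆ E → φ K = 0 from
    H _ ⊤ le_rfl K fun _ _ => trivial
  intro d
  induction d with
  | zero =>
    intro E hE K hK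
    obtain rfl := Submodule.finrank_eq_zero.1 (Nat.le_zero.1 hE)
    refine hsymm K fun y hy => ?_
    have : y = 0 := by simpa using hK hy
    rwa [this, neg_zero, ← this]
  | succ d ih =>
    intro E hE K hK
    rcases hE.lt_or_eq with hE | hE
    · exact ih E (Nat.lt_succ_iff.1 hE) K hK
    have : Nontrivial E := Module.nontrivial_of_finrank_pos (R := ℝ) (by omega)
    have hμ : IsSimpleEven fun L : ConvexBody E => φ (mapIso E.subtypeₗᵢ L) :=
      { val := hφ.val.mapIso _
        trans := fun L x => by simp only [mapIso_translate, hφ.trans _ _]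
        even := fun L => by simp only [mapIso_reflect, hφ.even _]
        simple := fun L hL => by
          obtain ⟨p, hp⟩ := L.nonempty
          have hS : vectorSpan ℝ (L : Set E) ≠ ⊤ := fun h => by
            have h1 := (AffineSubspace.affineSpan_eq_top_iff_vectorSpan_eq_top_of_nonempty
              ℝ E E L.nonempty).2 h
            have h2 := L.convex.interior_nonempty_iff_affineSpan_eq_top.2 h1
            exact h2.ne_empty hL
          rw [← hφ.trans _ (E.subtypeₗᵢ (-p)), ← mapIso_translate]
          refine ih ((vectorSpan ℝ (L : Set E)).map E.subtype) ?_ _ ?_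
          · have h1 := Submodule.finrank_lt hS
            have h2 := Submodule.finrank_map_le E.subtype (vectorSpan ℝ (L : Set E))
            omega
          · rintro _ ⟨_, ⟨y, hy, z, rfl, rfl⟩, rfl⟩
            refine ⟨y - p, vsub_mem_vectorSpan ℝ hy hp, ?_⟩
            simp [sub_eq_add_neg]
        symm := fun L hL => hsymm _ (by
          rintro _ ⟨y, hy, rfl⟩
          exact ⟨-y, hL y hy, map_neg _ _⟩) }
    have himage : E.subtypeₗᵢ '' (E.subtypeₗᵢ ⁻¹' (K : Set V)) = K :=
      Set.image_preimage_eq_of_subset fun x hx => ⟨⟨x, hK hx⟩, rfl⟩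
    let L : ConvexBody E := ⟨E.subtypeₗᵢ ⁻¹' K, K.convex.linear_preimage E.subtype,
      E.closed_of_finiteDimensional.isClosedEmbedding_subtypeVal.isCompact_preimage K.isCompact,
      Set.image_nonempty.1 (himage.symm ▸ K.nonempty)⟩
    have hL : mapIso E.subtypeₗᵢ L = K := ConvexBody.ext himage
    rw [← hL]
    exact hμ.eq_zero (hφ.cont.comp (continuous_mapIso _)) L

/-- Klain's theorem, by induction on the degree. -/
theorem IsEvenVal.eq_zero_of_homog (k : ℕ) : ∀ {φ : ConvexBody V → ℝ}, IsEvenVal φ →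
    (∀ m : ℕ, 0 < m → ∀ K, φ ((m : ℝ) • K) = (m : ℝ) ^ k * φ K) →
    (∀ E : Submodule ℝ V, Module.finrank ℝ E ≤ k → ∀ K : ConvexBody V, (K : Set V) ⊆ E →
      φ K = 0) → ∀ K, φ K = 0 := by
  induction k with
  | zero =>
    intro φ hφ hhom hvan K
    have h0 : φ 0 = 0 := hvan ⊥ (by simp) 0 (by simp)
    have hconst : ∀ m : ℕ, φ (((m : ℝ) + 1)⁻¹ • K) = φ K := fun m => by
      have := hhom (m + 1) m.succ_pos (((m : ℝ) + 1)⁻¹ • K)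
      have hm : (m : ℝ) + 1 ≠ 0 := by positivity
      push_cast at this
      rw [smul_smul, mul_inv_cancel₀ hm, one_smul, pow_zero, one_mul] at this
      exact this.symm
    have hlim := (hφ.cont.tendsto 0).comp (tendsto_smul_zero K)
    simp only [Function.comp_def, hconst, h0] at hlim
    exact tendsto_nhds_unique tendsto_const_nhds hlim
  | succ k ih =>
    intro φ hφ hhom hvan
    have hincr : ∀ v K, φ (K + seg 0 v) = φ K := fun v K => by
      refine sub_eq_zero.1 (ih (hφ.segIncr v) (hφ.segIncr_homog hhom v) (fun E hE K hK => ?_) K)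
      have hfin : Module.finrank ℝ (E ⊔ ℝ ∙ v : Submodule ℝ V) ≤ k + 1 :=
        (Submodule.finrank_add_le_finrank_add_finrank E (ℝ ∙ v)).trans
          (add_le_add hE (finrank_span_le_card _ |>.trans (by simp)))
      have hKE : (K : Set V) ⊆ (E ⊔ ℝ ∙ v : Submodule ℝ V) := fun x hx =>
        Submodule.mem_sup_left (hK hx)
      have h1 := hvan _ hfin K hKE
      have h2 := hvan _ hfin (K + seg 0 v) (by
        rintro _ ⟨x, hx, y, hy, rfl⟩
        refine Submodule.add_mem _ (hKE hx) ?_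
        exact (E ⊔ ℝ ∙ v).convex.segment_subset (Submodule.zero_mem _)
          (Submodule.mem_sup_right (Submodule.mem_span_singleton_self v)) hy)
      rw [_root_.segIncr, h1, h2, sub_zero]
    have h0 : φ 0 = 0 := hvan ⊥ (by simp) 0 (by simp)
    exact hφ.eq_zero_of_symm fun S hS =>
      _root_.eq_zero_of_symm hφ.cont hφ.trans hincr h0 hS

/-- A property of bodies in `k`-dimensional subspaces passes to bodies in subspaces of smaller
dimension. -/
theorem forall_subspace_le {k : ℕ} (hk : k ≤ Module.finrank ℝ V) {p : ConvexBody V → Prop}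
    (h : ∀ E : Submodule ℝ V, Module.finrank ℝ E = k → ∀ K : ConvexBody V, (K : Set V) ⊆ E → p K)
    (E : Submodule ℝ V) (hE : Module.finrank ℝ E ≤ k) (K : ConvexBody V) (hK : (K : Set V) ⊆ E) :
    p K := by
  obtain ⟨j, hj⟩ := Nat.exists_eq_add_of_le hE
  induction j generalizing E with
  | zero => exact h E hj.symm K hK
  | succ j ih =>
    have hlt : Module.finrank ℝ E < Module.finrank ℝ V := by omega
    obtain ⟨x, hx⟩ := E.exists_of_finrank_lt hlt
    have hxE : x ∉ E := by simpa using hx 1 one_ne_zero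
    have hlt' : E < E ⊔ ℝ ∙ x := left_lt_sup.2 (by simpa using hxE)
    have h1 := Submodule.finrank_lt_finrank_of_lt hlt'
    have h2 : Module.finrank ℝ (E ⊔ ℝ ∙ x : Submodule ℝ V) ≤ Module.finrank ℝ E + 1 :=
      (Submodule.finrank_add_le_finrank_add_finrank E (ℝ ∙ x)).trans
        (Nat.add_le_add_left (finrank_span_le_card _ |>.trans (by simp)) _)
    exact ih (E ⊔ ℝ ∙ x) (by omega) (hK.trans hlt'.le) (by omega)

end Inner

end Klain


/-- **Klain's embedding theorem.** A continuous, translation invariant, even valuation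
on `ℝⁿ`, homogeneous of degree `k`, which vanishes on all convex bodies contained in some
`k`-dimensional linear subspace, vanishes identically. -/
theorem klain_embedding_injective (n k : ℕ) (hn : 1 ≤ n) (hk : k ≤ n)
    (φ : ConvexBody (Eucl n) → ℝ)
    (hval : IsValuation φ) (hcont : Continuous φ) (htrans : TransInv φ)
    (hhom : Homog k φ) (heven : EvenVal φ)
    (hvanish : ∀ E : Submodule ℝ (Eucl n), Module.finrank ℝ E = k →
      ∀ K : ConvexBody (Eucl n), (K : Set (Eucl n)) ⊆ (E : Set (Eucl n)) → φ K = 0) :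
    ∀ K : ConvexBody (Eucl n), φ K = 0 := by
  refine IsEvenVal.eq_zero_of_homog k ⟨hval, hcont, htrans, heven⟩
    (fun m hm K => hhom K m (by exact_mod_cast hm)) ?_
  exact forall_subspace_le (by simpa using hk) hvanish
end
end

section
/- Let n ≥ 2 and 0 < k < n. Then both the space Val_k^+ of continuous, translation-invariant, even valuations on ℝⁿ homogeneous of degree k and the space Val_k^− of continuous, translation-invariant, odd valuations on ℝⁿ homogeneous of degree k are infinite-dimensional real vector spaces. -/
open MeasureTheory Pointwise
open scoped NNReal ENNReal

noncomputable section

open Filter Topology Metric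

section FiberSup

variable {V : Type*} [NormedAddCommGroup V] [NormedSpace ℝ V]
  {Y : Type*} [NormedAddCommGroup Y] [InnerProductSpace ℝ Y]

/-- The supremum of the functional `ℓ` over the slice of `K` above `y` along the projection `P`;
it is `0` if the slice is empty. -/
def fiberSup (P : V →L[ℝ] Y) (ℓ : V →L[ℝ] ℝ) (K : ConvexBody V) (y : Y) : ℝ :=
  sSup (ℓ '' ((K : Set V) ∩ P ⁻¹' {y}))

variable (P : V →L[ℝ] Y) (ℓ : V →L[ℝ] ℝ)

theorem fiberSup_of_notMem {K : ConvexBody V} {y : Y} (hy : y ∉ P '' (K : Set V)) :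
    fiberSup P ℓ K y = 0 := by
  have : (K : Set V) ∩ P ⁻¹' {y} = ∅ := by
    ext z
    simp only [Set.mem_inter_iff, Set.mem_preimage, Set.mem_singleton_iff,
      Set.mem_empty_iff_false, iff_false]
    exact fun h => hy ⟨z, h.1, h.2⟩
  simp [fiberSup, this]

theorem isGreatest_fiberSup {K : ConvexBody V} {y : Y} (hy : y ∈ P '' (K : Set V)) :
    IsGreatest (ℓ '' ((K : Set V) ∩ P ⁻¹' {y})) (fiberSup P ℓ K y) := by
  refine IsCompact.isGreatest_sSup ?_ ?_
  · exact (K.isCompact.inter_right (isClosed_singleton.preimage P.continuous)).image ℓ.continuous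
  · obtain ⟨z, hz, rfl⟩ := hy
    exact ⟨ℓ z, z, ⟨hz, rfl⟩, rfl⟩

theorem exists_eq_fiberSup {K : ConvexBody V} {y : Y} (hy : y ∈ P '' (K : Set V)) :
    ∃ z ∈ K, P z = y ∧ ℓ z = fiberSup P ℓ K y := by
  obtain ⟨z, ⟨hz, hz'⟩, h⟩ := (isGreatest_fiberSup P ℓ hy).1
  exact ⟨z, hz, hz', h⟩

theorem le_fiberSup {K : ConvexBody V} {z : V} (hz : z ∈ K) : ℓ z ≤ fiberSup P ℓ K (P z) :=
  (isGreatest_fiberSup P ℓ ⟨z, hz, rfl⟩).2 ⟨z, ⟨hz, rfl⟩, rfl⟩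

theorem fiberSup_eq {K : ConvexBody V} {z : V} (hz : z ∈ K)
    (h : ∀ w ∈ K, P w = P z → ℓ w ≤ ℓ z) : fiberSup P ℓ K (P z) = ℓ z := by
  refine IsGreatest.csSup_eq ⟨⟨z, ⟨hz, rfl⟩, rfl⟩, ?_⟩
  rintro _ ⟨w, ⟨hw, hw'⟩, rfl⟩
  exact h w hw hw'

theorem fiberSup_union_add_inter {K L M I : ConvexBody V}
    (hM : (M : Set V) = (K : Set V) ∪ (L : Set V)) (hI : (I : Set V) = (K : Set V) ∩ (L : Set V))
    (y : Y) : fiberSup P ℓ M y + fiberSup P ℓ I y = fiberSup P ℓ K y + fiberSup P ℓ L y := by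
  wlog h : fiberSup P ℓ L y ≤ fiberSup P ℓ K y ∧ y ∈ P '' (K : Set V) ∧ y ∈ P '' (L : Set V)
    generalizing K L
  · by_cases hK : y ∈ P '' (K : Set V)
    · by_cases hL : y ∈ P '' (L : Set V)
      · rw [add_comm (fiberSup P ℓ K y)]
        refine this (by rw [hM, Set.union_comm]) (by rw [hI, Set.inter_comm]) ?_
        exact ⟨le_of_not_ge fun h' => h ⟨h', hK, hL⟩, hL, hK⟩
      · have hIy : y ∉ P '' (I : Set V) := fun h' =>
          hL (Set.image_mono (hI ▸ Set.inter_subset_right) h')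
        rw [fiberSup_of_notMem P ℓ hL, fiberSup_of_notMem P ℓ hIy]
        have : (M : Set V) ∩ P ⁻¹' {y} = (K : Set V) ∩ P ⁻¹' {y} := by
          ext z
          simp only [hM, Set.mem_inter_iff, Set.mem_union, Set.mem_preimage, Set.mem_singleton_iff]
          exact ⟨fun ⟨hz, hy⟩ => ⟨hz.resolve_right fun hz => hL ⟨z, hz, hy⟩, hy⟩,
            fun ⟨hz, hy⟩ => ⟨Or.inl hz, hy⟩⟩
        simp [fiberSup, this]
    · have hIy : y ∉ P '' (I : Set V) := fun h' =>
        hK (Set.image_mono (hI ▸ Set.inter_subset_left) h')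
      rw [fiberSup_of_notMem P ℓ hK, fiberSup_of_notMem P ℓ hIy]
      have : (M : Set V) ∩ P ⁻¹' {y} = (L : Set V) ∩ P ⁻¹' {y} := by
        ext z
        simp only [hM, Set.mem_inter_iff, Set.mem_union, Set.mem_preimage, Set.mem_singleton_iff]
        exact ⟨fun ⟨hz, hy⟩ => ⟨hz.resolve_left fun hz => hK ⟨z, hz, hy⟩, hy⟩,
          fun ⟨hz, hy⟩ => ⟨Or.inr hz, hy⟩⟩
      simp [fiberSup, this]
  obtain ⟨hle, hK, hL⟩ := h
  obtain ⟨p, hp, hpy, hpℓ⟩ := exists_eq_fiberSup P ℓ hK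
  obtain ⟨q, hq, hqy, hqℓ⟩ := exists_eq_fiberSup P ℓ hL
  have mem_M {z : V} : z ∈ M ↔ z ∈ K ∨ z ∈ L := by
    simp only [← SetLike.mem_coe, hM, Set.mem_union]
  have mem_I {z : V} : z ∈ I ↔ z ∈ K ∧ z ∈ L := by
    simp only [← SetLike.mem_coe, hI, Set.mem_inter_iff]
  have hMy : fiberSup P ℓ M y = fiberSup P ℓ K y := by
    rw [← hpℓ, ← hpy]
    refine fiberSup_eq P ℓ (mem_M.2 (Or.inl hp)) fun w hw hwp => ?_
    rw [hpℓ]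
    rcases mem_M.1 hw with hw | hw
    · simpa only [hwp, hpy] using le_fiberSup P ℓ hw
    · refine le_trans ?_ hle
      simpa only [hwp, hpy] using le_fiberSup P ℓ hw
  have hsub : segment ℝ q p ⊆ (M : Set V) :=
    M.convex.segment_subset (mem_M.2 (Or.inr hq)) (mem_M.2 (Or.inl hp))
  obtain ⟨z, hz, hzK, hzL⟩ := isPreconnected_closed_iff.1 (convex_segment q p).isPreconnected
    (K : Set V) (L : Set V) K.isClosed L.isClosed (hM ▸ hsub)
    ⟨p, right_mem_segment ℝ q p, hp⟩ ⟨q, left_mem_segment ℝ q p, hq⟩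
  obtain ⟨a, b, ha, hb, hab, rfl⟩ := hz
  have hPz : P (a • q + b • p) = y := by
    rw [map_add, map_smul, map_smul, hpy, hqy, ← add_smul, hab, one_smul]
  have hℓz : fiberSup P ℓ L y ≤ ℓ (a • q + b • p) := by
    rw [map_add, map_smul, map_smul, hpℓ, hqℓ, smul_eq_mul, smul_eq_mul]
    calc fiberSup P ℓ L y = a * fiberSup P ℓ L y + b * fiberSup P ℓ L y := by
          rw [← add_mul, hab, one_mul]
      _ ≤ _ := by gcongr
  have hIy : fiberSup P ℓ I y = fiberSup P ℓ L y := by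
    refine le_antisymm ?_ (hℓz.trans ?_)
    · obtain ⟨w, hw, hwy, hwℓ⟩ := exists_eq_fiberSup P ℓ (K := I) (y := y)
        ⟨_, mem_I.2 ⟨hzK, hzL⟩, hPz⟩
      rw [← hwℓ, ← hwy]
      exact le_fiberSup P ℓ (mem_I.1 hw).2
    · rw [← hPz]
      exact le_fiberSup P ℓ (mem_I.2 ⟨hzK, hzL⟩)
  rw [hMy, hIy]

theorem fiberSup_translate_of_mem {K : ConvexBody V} {x : V} {y : Y}
    (hy : y ∈ P '' (K : Set V)) :
    fiberSup P ℓ (K.translate x) (y + P x) = fiberSup P ℓ K y + ℓ x := by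
  obtain ⟨z, hz, rfl, hzℓ⟩ := exists_eq_fiberSup P ℓ hy
  rw [← hzℓ, ← map_add, ← map_add]
  refine fiberSup_eq P ℓ (Set.add_mem_add hz rfl) ?_
  rintro _ ⟨w, hw, _, rfl, rfl⟩ hwz
  simp only [map_add, add_left_inj] at hwz
  rw [map_add, map_add, hzℓ, ← hwz]
  gcongr
  exact le_fiberSup P ℓ hw

theorem fiberSup_translate (K : ConvexBody V) (x : V) (y : Y) :
    fiberSup P ℓ (K.translate x) y =
      fiberSup P ℓ K (y - P x) + (P '' (K : Set V)).indicator (fun _ => ℓ x) (y - P x) := by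
  by_cases hy : y - P x ∈ P '' (K : Set V)
  · have := fiberSup_translate_of_mem P ℓ (x := x) hy
    rw [sub_add_cancel] at this
    rw [this, Set.indicator_of_mem hy]
  · rw [Set.indicator_of_notMem hy, fiberSup_of_notMem P ℓ hy, fiberSup_of_notMem, add_zero]
    rintro ⟨_, ⟨w, hw, _, rfl, rfl⟩, rfl⟩
    exact hy ⟨w, hw, by simp⟩

theorem fiberSup_dilate (K : ConvexBody V) {t : ℝ} (ht : 0 < t) (y : Y) :
    fiberSup P ℓ (K.dilate t) y = t * fiberSup P ℓ K (t⁻¹ • y) := by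
  by_cases hy : t⁻¹ • y ∈ P '' (K : Set V)
  · obtain ⟨z, hz, hzy, hzℓ⟩ := exists_eq_fiberSup P ℓ hy
    have hy' : y = P (t • z) := by rw [map_smul, hzy, smul_inv_smul₀ ht.ne']
    rw [← hzℓ, hy', ← smul_eq_mul, ← map_smul]
    refine fiberSup_eq P ℓ (Set.smul_mem_smul_set hz) ?_
    rintro _ ⟨w, hw, rfl⟩ hwz
    simp only [map_smul, smul_eq_mul] at hwz ⊢
    have := smul_right_injective Y ht.ne' hwz
    rw [hzℓ, ← hzy, ← this]
    exact mul_le_mul_of_nonneg_left (le_fiberSup P ℓ hw) ht.le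
  · rw [fiberSup_of_notMem P ℓ hy, fiberSup_of_notMem, mul_zero]
    rintro ⟨_, ⟨w, hw, rfl⟩, rfl⟩
    exact hy ⟨w, hw, by simp [smul_smul, inv_mul_cancel₀ ht.ne']⟩

theorem fiberSup_reflect (K : ConvexBody V) (y : Y) :
    fiberSup P ℓ K.reflect y = fiberSup P (-ℓ) K (-y) := by
  unfold fiberSup
  congr 1
  ext a
  constructor
  · rintro ⟨z, ⟨hz, rfl⟩, rfl⟩
    exact ⟨-z, ⟨hz, by simp⟩, by simp⟩
  · rintro ⟨z, ⟨hz, hzy⟩, rfl⟩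
    refine ⟨-z, ⟨?_, ?_⟩, by simp⟩
    · exact Set.neg_mem_neg.2 hz
    · simp only [Set.mem_preimage, Set.mem_singleton_iff] at hzy ⊢
      rw [map_neg, hzy, neg_neg]

theorem abs_fiberSup_le {K : ConvexBody V} {R : ℝ} (hK : (K : Set V) ⊆ closedBall 0 R) (y : Y) :
    |fiberSup P ℓ K y| ≤ (closedBall (0 : Y) (‖P‖ * R)).indicator (fun _ => ‖ℓ‖ * R) y := by
  by_cases hy : y ∈ P '' (K : Set V)
  · obtain ⟨z, hz, rfl, hzℓ⟩ := exists_eq_fiberSup P ℓ hy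
    have hzR : ‖z‖ ≤ R := by simpa using hK hz
    rw [← hzℓ, Set.indicator_of_mem]
    · exact ℓ.le_opNorm_of_le hzR
    · simpa using P.le_opNorm_of_le hzR
  · rw [fiberSup_of_notMem P ℓ hy, abs_zero]
    refine Set.indicator_nonneg (fun _ _ => mul_nonneg (norm_nonneg _) ?_) _
    obtain ⟨z, hz⟩ := K.nonempty
    exact (norm_nonneg z).trans (by simpa using hK hz)

theorem measurable_fiberSup [MeasurableSpace Y] [BorelSpace Y] (K : ConvexBody V) :
    Measurable (fiberSup P ℓ K) := by
  refine measurable_of_Ici fun c => ?_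
  have hc : MeasurableSet (P '' ((K : Set V) ∩ ℓ ⁻¹' Set.Ici c)) :=
    ((K.isCompact.inter_right (isClosed_Ici.preimage ℓ.continuous)).image
      P.continuous).isClosed.measurableSet
  have hP : MeasurableSet (P '' (K : Set V)) :=
    (K.isCompact.image P.continuous).isClosed.measurableSet
  have key : fiberSup P ℓ K ⁻¹' Set.Ici c =
      P '' ((K : Set V) ∩ ℓ ⁻¹' Set.Ici c) ∪ ((P '' (K : Set V))ᶜ ∩ {_y | c ≤ 0}) := by
    ext y
    by_cases hy : y ∈ P '' (K : Set V)
    · simp only [Set.mem_preimage, Set.mem_Ici, Set.mem_union, Set.mem_inter_iff,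
        Set.mem_compl_iff, hy, not_true_eq_false, false_and, or_false]
      constructor
      · intro h
        obtain ⟨z, hz, hzy, hzℓ⟩ := exists_eq_fiberSup P ℓ hy
        exact ⟨z, ⟨hz, by simpa [hzℓ] using h⟩, hzy⟩
      · rintro ⟨z, ⟨hz, hzc⟩, rfl⟩
        exact le_trans hzc (le_fiberSup P ℓ hz)
    · have : y ∉ P '' ((K : Set V) ∩ ℓ ⁻¹' Set.Ici c) := fun h =>
        hy (Set.image_mono Set.inter_subset_left h)
      simp only [Set.mem_preimage, Set.mem_Ici, Set.mem_union, Set.mem_inter_iff,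
        Set.mem_compl_iff, hy, not_false_eq_true, true_and, this, false_or,
        fiberSup_of_notMem P ℓ hy, Set.mem_ofPred_eq]
  rw [key]
  exact hc.union (hP.compl.inter (MeasurableSet.const _))

theorem ConvexBody.eventually_exists_dist_lt (K₀ : ConvexBody V) {δ : ℝ} (hδ : 0 < δ) :
    ∀ᶠ K : ConvexBody V in 𝓝 K₀,
      (∀ z ∈ K, ∃ w ∈ K₀, dist z w < δ) ∧ ∀ w ∈ K₀, ∃ z ∈ K, dist w z < δ := by
  filter_upwards [ball_mem_nhds K₀ hδ] with K hK
  rw [mem_ball] at hK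
  refine ⟨fun z hz => ?_, fun w hw => ?_⟩
  · exact exists_dist_lt_of_hausdorffDist_lt hz (by rwa [ConvexBody.hausdorffDist_coe])
      ConvexBody.hausdorffEDist_ne_top
  · exact exists_dist_lt_of_hausdorffDist_lt hw
      (by rwa [ConvexBody.hausdorffDist_coe, dist_comm]) ConvexBody.hausdorffEDist_ne_top

theorem ConvexBody.eventually_disjoint {K₀ : ConvexBody V} {A : Set V} (hA : IsClosed A)
    (h : ∀ z ∈ K₀, z ∉ A) : ∀ᶠ K : ConvexBody V in 𝓝 K₀, ∀ z ∈ K, z ∉ A := by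
  obtain ⟨δ, hδ, hsub⟩ := K₀.isCompact.exists_thickening_subset_open hA.isOpen_compl h
  filter_upwards [K₀.eventually_exists_dist_lt hδ] with K hK z hz
  obtain ⟨w, hw, hzw⟩ := hK.1 z hz
  exact hsub (mem_thickening_iff.2 ⟨w, hw, hzw⟩)

/-- A closed convex set that is `δ`-dense in a ball of radius larger than `δ` contains the center
of the ball. -/
theorem mem_of_ball_subset_thickening {D : Set Y} (hD : Convex ℝ D) (hD' : IsClosed D)
    {y : Y} {r δ : ℝ} (hδ : 0 < δ) (hδr : δ < r) (h : ball y r ⊆ thickening δ D) : y ∈ D := by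
  by_contra hy
  obtain ⟨f, u, hfy, hf⟩ := geometric_hahn_banach_point_closed hD hD' hy
  have hne : ∃ b, b ∈ D := by
    obtain ⟨b, hb, -⟩ := mem_thickening_iff.1 (h (mem_ball_self (hδ.trans hδr)))
    exact ⟨b, hb⟩
  have hf0 : 0 < ‖f‖ := by
    rw [norm_pos_iff]
    rintro rfl
    obtain ⟨b, hb⟩ := hne
    have := hf b hb
    simp only [_root_.zero_apply] at this hfy
    linarith
  obtain ⟨s, hs, hsr⟩ := exists_between hδr
  have hs0 : 0 < s := hδ.trans hs
  obtain ⟨v, hv, hfv⟩ : ∃ v : Y, ‖v‖ < r ∧ δ * ‖f‖ < f v := by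
    have hlt : δ / s * ‖f‖ < ‖f‖ := by
      have : δ / s < 1 := (div_lt_one hs0).2 hs
      nlinarith
    obtain ⟨v, hv, hfv⟩ := f.exists_lt_apply_of_lt_opNorm hlt
    have hfv' : δ * ‖f‖ < s * ‖f v‖ := by
      have := mul_lt_mul_of_pos_left hfv hs0
      rwa [← mul_assoc, mul_div_cancel₀ _ hs0.ne'] at this
    rcases le_total 0 (f v) with h0 | h0
    · refine ⟨s • v, ?_, ?_⟩
      · rw [norm_smul, Real.norm_of_nonneg hs0.le]; nlinarith
      · rwa [Real.norm_of_nonneg h0, ← smul_eq_mul s, ← map_smul] at hfv'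
    · refine ⟨(-s) • v, ?_, ?_⟩
      · rw [norm_smul, norm_neg, Real.norm_of_nonneg hs0.le]; nlinarith
      · rw [Real.norm_of_nonpos h0] at hfv'
        rw [map_smul, smul_eq_mul]
        linarith
  obtain ⟨b, hb, hbd⟩ := mem_thickening_iff.1 (h (show y - v ∈ ball y r by simpa using hv))
  have h1 : f b - f (y - v) ≤ ‖f‖ * δ := by
    rw [← map_sub]
    refine (le_abs_self _).trans (f.le_opNorm_of_le ?_)
    rw [← dist_eq_norm, dist_comm]
    exact hbd.le
  have h2 := hf b hb
  rw [map_sub] at h1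
  linarith

/-- Slices above interior points of the projection can be approximated from nearby bodies. -/
theorem ConvexBody.eventually_exists_lt {K₀ : ConvexBody V} {z₀ : V} (hz₀ : z₀ ∈ K₀)
    (hy : P z₀ ∈ interior (P '' (K₀ : Set V))) {c : ℝ} (hc : c < ℓ z₀) :
    ∀ᶠ K : ConvexBody V in 𝓝 K₀, ∃ z ∈ K, P z = P z₀ ∧ c < ℓ z := by
  obtain ⟨r, hr, hball⟩ := Metric.isOpen_iff.1 isOpen_interior _ hy
  replace hball := hball.trans interior_subset
  obtain ⟨c₁, hc₁, hc₁'⟩ := exists_between hc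
  obtain ⟨c₂, hc₂, hc₂'⟩ := exists_between hc₁'
  obtain ⟨C, hC⟩ := (K₀.isCompact.image ℓ.continuous).isBounded.exists_norm_le
  have hCK {z : V} (hz : z ∈ K₀) : |ℓ z| ≤ C := hC _ ⟨z, hz, rfl⟩
  have hC0 : 0 ≤ C := (abs_nonneg _).trans (hCK hz₀)
  obtain ⟨t, ht0, ht1, htC⟩ : ∃ t : ℝ, 0 < t ∧ t ≤ 1 ∧ t * (2 * C) ≤ ℓ z₀ - c₂ := by
    have hpos : 0 < ℓ z₀ - c₂ := sub_pos.2 hc₂'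
    refine ⟨min 1 ((ℓ z₀ - c₂) / (2 * C + 1)), by positivity, min_le_left _ _, ?_⟩
    calc min 1 ((ℓ z₀ - c₂) / (2 * C + 1)) * (2 * C)
        ≤ (ℓ z₀ - c₂) / (2 * C + 1) * (2 * C + 1) := by
          gcongr
          · exact min_le_right _ _
          · linarith
      _ = ℓ z₀ - c₂ := div_mul_cancel₀ _ (by positivity)
  have hsurj : ∀ q ∈ ball (P z₀) (t * r), ∃ w ∈ K₀, P w = q ∧ c₂ ≤ ℓ w := by
    intro q hq
    obtain ⟨w, hw, hwq⟩ : P z₀ + t⁻¹ • (q - P z₀) ∈ P '' (K₀ : Set V) := by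
      refine hball ?_
      rw [mem_ball, dist_eq_norm] at hq ⊢
      rw [add_sub_cancel_left, norm_smul, norm_inv, Real.norm_of_nonneg ht0.le,
        inv_mul_lt_iff₀ ht0]
      exact hq
    refine ⟨(1 - t) • z₀ + t • w, K₀.convex hz₀ hw (by linarith) ht0.le (by ring), ?_, ?_⟩
    · rw [map_add, map_smul, map_smul, hwq, smul_add, smul_inv_smul₀ ht0.ne']
      module
    · rw [map_add, map_smul, map_smul, smul_eq_mul, smul_eq_mul]
      have h1 := abs_le.1 (hCK hw)
      have h2 := abs_le.1 (hCK hz₀)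
      nlinarith
  have hs : 0 < t * r := mul_pos ht0 hr
  obtain ⟨δ, hδ, hδP, hδℓ⟩ : ∃ δ : ℝ, 0 < δ ∧ ‖P‖ * δ < t * r / 2 ∧ ‖ℓ‖ * δ < c₂ - c₁ := by
    have h1 : Tendsto (fun δ : ℝ => ‖P‖ * δ) (𝓝[>] 0) (𝓝 0) := by
      simpa using (tendsto_id.const_mul ‖P‖).mono_left (nhdsWithin_le_nhds (a := (0 : ℝ)))
    have h2 : Tendsto (fun δ : ℝ => ‖ℓ‖ * δ) (𝓝[>] 0) (𝓝 0) := by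
      simpa using (tendsto_id.const_mul ‖ℓ‖).mono_left (nhdsWithin_le_nhds (a := (0 : ℝ)))
    obtain ⟨δ, hδ⟩ := ((h1.eventually_lt_const (half_pos hs)).and
      ((h2.eventually_lt_const (sub_pos.2 hc₂)).and self_mem_nhdsWithin)).exists
    exact ⟨δ, hδ.2.2, hδ.1, hδ.2.1⟩
  filter_upwards [K₀.eventually_exists_dist_lt hδ] with K hK
  suffices h : P z₀ ∈ P '' ((K : Set V) ∩ ℓ ⁻¹' Set.Ici c₁) by
    obtain ⟨z, ⟨hz, hzc⟩, hzP⟩ := h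
    exact ⟨z, hz, hzP, hc₁.trans_le hzc⟩
  refine mem_of_ball_subset_thickening (D := P '' ((K : Set V) ∩ ℓ ⁻¹' Set.Ici c₁))
    (δ := t * r / 2) (r := t * r) ?_ ?_ (half_pos hs) (half_lt_self hs) ?_
  · exact (K.convex.inter ((convex_Ici c₁).linear_preimage ℓ.toLinearMap)).linear_image
      P.toLinearMap
  · exact ((K.isCompact.inter_right (isClosed_Ici.preimage ℓ.continuous)).image
      P.continuous).isClosed
  · intro q hq
    obtain ⟨w, hw, rfl, hwc⟩ := hsurj q hq
    obtain ⟨z, hz, hwz⟩ := hK.2 w hw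
    rw [dist_eq_norm] at hwz
    refine mem_thickening_iff.2 ⟨P z, ⟨z, ⟨hz, ?_⟩, rfl⟩, ?_⟩
    · have := (le_abs_self _).trans (ℓ.le_opNorm_of_le hwz.le)
      rw [map_sub] at this
      simp only [Set.mem_preimage, Set.mem_Ici]
      linarith
    · rw [dist_eq_norm, ← map_sub]
      exact (P.le_opNorm_of_le hwz.le).trans_lt hδP

theorem continuousAt_fiberSup {K₀ : ConvexBody V} {y : Y}
    (hy : y ∉ frontier (P '' (K₀ : Set V))) :
    ContinuousAt (fun K : ConvexBody V => fiberSup P ℓ K y) K₀ := by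
  by_cases hy₀ : y ∈ P '' (K₀ : Set V)
  · have hint : y ∈ interior (P '' (K₀ : Set V)) := by
      by_contra h
      exact hy ⟨subset_closure hy₀, h⟩
    obtain ⟨z₀, hz₀, rfl, hzℓ⟩ := exists_eq_fiberSup P ℓ hy₀
    refine tendsto_order.2 ⟨fun c hc => ?_, fun c hc => ?_⟩
    · filter_upwards [ConvexBody.eventually_exists_lt P ℓ hz₀ hint (hc.trans_eq hzℓ.symm)]
        with K hK
      obtain ⟨z, hz, hzP, hcz⟩ := hK
      exact hcz.trans_le (hzP ▸ le_fiberSup P ℓ hz)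
    · have hA : IsClosed (P ⁻¹' {P z₀} ∩ ℓ ⁻¹' Set.Ici c) :=
        (isClosed_singleton.preimage P.continuous).inter (isClosed_Ici.preimage ℓ.continuous)
      have hd : ∀ z ∈ K₀, z ∉ P ⁻¹' {P z₀} ∩ ℓ ⁻¹' Set.Ici c := by
        rintro z hz ⟨hzP, hzc⟩
        have hzP' : P z = P z₀ := hzP
        have := le_fiberSup P ℓ hz
        rw [hzP'] at this
        exact absurd hc (not_lt.2 (le_trans hzc this))
      filter_upwards [ConvexBody.eventually_exists_lt P ℓ hz₀ hint (sub_one_lt _),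
        ConvexBody.eventually_disjoint hA hd] with K hK hKd
      obtain ⟨z, hz, hzP, -⟩ := hK
      obtain ⟨w, hw, hwP, hwℓ⟩ := exists_eq_fiberSup P ℓ (K := K) ⟨z, hz, hzP⟩
      rw [← hwℓ]
      by_contra h
      exact hKd w hw ⟨hwP, not_lt.1 h⟩
  · have hd : ∀ᶠ K : ConvexBody V in 𝓝 K₀, ∀ z ∈ K, z ∉ P ⁻¹' {y} :=
      ConvexBody.eventually_disjoint (isClosed_singleton.preimage P.continuous)
        fun z hz hzy => hy₀ ⟨z, hz, hzy⟩
    refine continuousAt_const.congr (f := fun _ => (0 : ℝ)) ?_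
    filter_upwards [hd] with K hK
    refine (fiberSup_of_notMem P ℓ ?_).symm
    rintro ⟨z, hz, hzy⟩
    exact hK z hz hzy

variable [FiniteDimensional ℝ Y] [MeasurableSpace Y] [BorelSpace Y]

theorem integrable_indicator_closedBall (R c : ℝ) :
    Integrable ((closedBall (0 : Y) R).indicator fun _ => c) :=
  (integrable_indicator_iff isClosed_closedBall.measurableSet).2
    (integrableOn_const (isCompact_closedBall (0 : Y) R).measure_lt_top.ne)

theorem integrable_fiberSup (K : ConvexBody V) : Integrable (fiberSup P ℓ K) := by
  obtain ⟨R, hR⟩ := K.isBounded.subset_closedBall 0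
  exact (integrable_indicator_closedBall (‖P‖ * R) (‖ℓ‖ * R)).mono'
    (measurable_fiberSup P ℓ K).aestronglyMeasurable (ae_of_all _ fun y => abs_fiberSup_le P ℓ hR y)

/-- The integral over `y` of the support function at `ℓ` of the slice of `K` above `y`. -/
def fiberIntegral (K : ConvexBody V) : ℝ := ∫ y, fiberSup P ℓ K y

theorem isValuation_fiberIntegral : IsValuation (fiberIntegral P ℓ) := by
  intro K L M I hM hI
  unfold fiberIntegral
  rw [← integral_add (integrable_fiberSup P ℓ M) (integrable_fiberSup P ℓ I),
    ← integral_add (integrable_fiberSup P ℓ K) (integrable_fiberSup P ℓ L)]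
  exact integral_congr_ae (ae_of_all _ fun y => fiberSup_union_add_inter P ℓ hM hI y)

theorem continuous_fiberIntegral : Continuous (fiberIntegral P ℓ) := by
  refine continuous_iff_continuousAt.2 fun K₀ => ?_
  obtain ⟨R, hR⟩ := K₀.isBounded.subset_closedBall 0
  have hbound : ∀ᶠ K : ConvexBody V in 𝓝 K₀, (K : Set V) ⊆ closedBall 0 (R + 1) := by
    filter_upwards [K₀.eventually_exists_dist_lt one_pos] with K hK z hz
    obtain ⟨w, hw, hzw⟩ := hK.1 z hz
    rw [mem_closedBall]
    linarith [dist_triangle z w 0, mem_closedBall.1 (hR hw)]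
  refine continuousAt_of_dominated
    (Eventually.of_forall fun K => (measurable_fiberSup P ℓ K).aestronglyMeasurable)
    (hbound.mono fun K hK => ae_of_all _ fun y => abs_fiberSup_le P ℓ hK y)
    (integrable_indicator_closedBall _ _) ?_
  have hnull : volume (frontier (P '' (K₀ : Set V))) = 0 :=
    (K₀.convex.linear_image P.toLinearMap).addHaar_frontier volume
  filter_upwards [measure_eq_zero_iff_ae_notMem.1 hnull] with y hy
  exact continuousAt_fiberSup P ℓ hy

theorem fiberIntegral_translate (K : ConvexBody V) (x : V) :
    fiberIntegral P ℓ (K.translate x) =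
      fiberIntegral P ℓ K + volume.real (P '' (K : Set V)) * ℓ x := by
  have hc : IsCompact (P '' (K : Set V)) := K.isCompact.image P.continuous
  unfold fiberIntegral
  simp_rw [fiberSup_translate P ℓ K x]
  rw [integral_sub_right_eq_self (fun y => fiberSup P ℓ K y +
      (P '' (K : Set V)).indicator (fun _ => ℓ x) y) (P x),
    integral_add (integrable_fiberSup P ℓ K)
      ((integrable_indicator_iff hc.isClosed.measurableSet).2
        (integrableOn_const hc.measure_lt_top.ne)),
    integral_indicator_const _ hc.isClosed.measurableSet, smul_eq_mul]

theorem fiberIntegral_dilate (K : ConvexBody V) {t : ℝ} (ht : 0 < t) :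
    fiberIntegral P ℓ (K.dilate t) = t ^ (Module.finrank ℝ Y + 1) * fiberIntegral P ℓ K := by
  unfold fiberIntegral
  simp_rw [fiberSup_dilate P ℓ K ht]
  rw [integral_const_mul,
    Measure.integral_comp_inv_smul_of_nonneg volume (fiberSup P ℓ K) ht.le, smul_eq_mul]
  ring

theorem fiberIntegral_reflect (K : ConvexBody V) :
    fiberIntegral P ℓ K.reflect = fiberIntegral P (-ℓ) K := by
  unfold fiberIntegral
  simp_rw [fiberSup_reflect]
  exact integral_neg_eq_self (fiberSup P (-ℓ) K) volume

/-- The part of `fiberIntegral` of parity `ε = ±1`. -/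
def fiberWidth (ε : ℝ) (K : ConvexBody V) : ℝ :=
  fiberIntegral P ℓ K + ε * fiberIntegral P (-ℓ) K

/-- A combination of three functionals `fiberWidth` which is translation invariant
when `ε = ±1`. -/
def sliceVal (ε : ℝ) (ℓ₁ ℓ₂ : V →L[ℝ] ℝ) (s : ℝ) (K : ConvexBody V) : ℝ :=
  fiberWidth P (ℓ₁ + s • ℓ₂) ε K - fiberWidth P ℓ₁ ε K + ε * s * fiberWidth P ℓ₂ ε K

variable (ℓ₁ ℓ₂ : V →L[ℝ] ℝ) (ε s : ℝ)

theorem isValuation_sliceVal : IsValuation (sliceVal P ε ℓ₁ ℓ₂ s) := by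
  intro K L M I hM hI
  have h (ℓ : V →L[ℝ] ℝ) := isValuation_fiberIntegral P ℓ K L M I hM hI
  simp only [sliceVal, fiberWidth]
  linear_combination h (ℓ₁ + s • ℓ₂) + ε * h (-(ℓ₁ + s • ℓ₂)) - h ℓ₁ - ε * h (-ℓ₁) +
    ε * s * (h ℓ₂ + ε * h (-ℓ₂))

theorem continuous_sliceVal : Continuous (sliceVal P ε ℓ₁ ℓ₂ s) := by
  have h (ℓ : V →L[ℝ] ℝ) := continuous_fiberIntegral P ℓ
  have hw (ℓ : V →L[ℝ] ℝ) : Continuous (fiberWidth P ℓ ε) := (h ℓ).add ((h (-ℓ)).const_mul ε)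
  exact ((hw _).sub (hw _)).add ((hw _).const_mul _)

theorem transInv_sliceVal {ε : ℝ} (hε : ε * ε = 1) : TransInv (sliceVal P ε ℓ₁ ℓ₂ s) := by
  intro K x
  simp only [sliceVal, fiberWidth, fiberIntegral_translate, _root_.neg_apply, _root_.add_apply,
    _root_.smul_apply, smul_eq_mul]
  linear_combination (-(s * volume.real (P '' (K : Set V)) * ℓ₂ x)) * hε

theorem homog_sliceVal : Homog (Module.finrank ℝ Y + 1) (sliceVal P ε ℓ₁ ℓ₂ s) := by
  intro K t ht
  simp only [sliceVal, fiberWidth, fiberIntegral_dilate P _ K ht]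
  ring

theorem sliceVal_reflect {ε : ℝ} (hε : ε * ε = 1) (K : ConvexBody V) :
    sliceVal P ε ℓ₁ ℓ₂ s K.reflect = ε * sliceVal P ε ℓ₁ ℓ₂ s K := by
  have h (ℓ : V →L[ℝ] ℝ) : fiberWidth P ℓ ε K.reflect = ε * fiberWidth P ℓ ε K := by
    simp only [fiberWidth, fiberIntegral_reflect, neg_neg]
    linear_combination (-fiberIntegral P (-ℓ) K) * hε
  simp only [sliceVal, h]
  ring

/-- The image under `J` of the product of the unit ball and the triangle with vertices
`(0, 0)`, `(-t, 1)` and `(-B, 1)`. -/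
def ballTriangle (J : Y × ℝ × ℝ →L[ℝ] V) (t B : ℝ) : ConvexBody V where
  carrier := J '' (closedBall (0 : Y) 1 ×ˢ convexHull ℝ {((0 : ℝ), (0 : ℝ)), (-t, 1), (-B, 1)})
  convex' := ((convex_closedBall _ _).prod (convex_convexHull ℝ _)).linear_image J.toLinearMap
  isCompact' := ((isCompact_closedBall _ _).prod
    ((Set.toFinite _).isCompact_convexHull ℝ)).image J.continuous
  nonempty' := ⟨J (0, 0, 0), _, ⟨by simp, subset_convexHull ℝ _ (by simp)⟩, rfl⟩

variable {P ℓ₁ ℓ₂} {J : Y × ℝ × ℝ →L[ℝ] V}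

theorem fiberIntegral_ballTriangle (hP : ∀ p, P (J p) = p.1) {ℓ : V →L[ℝ] ℝ} {α β : ℝ}
    (hℓ : ∀ p, ℓ (J p) = α * p.2.1 + β * p.2.2) (t B : ℝ) :
    fiberIntegral P ℓ (ballTriangle J t B) =
      volume.real (closedBall (0 : Y) 1) * max 0 (max (β - α * t) (β - α * B)) := by
  set m := max 0 (max (β - α * t) (β - α * B)) with hm
  set T : Set (ℝ × ℝ) := {((0 : ℝ), (0 : ℝ)), (-t, 1), (-B, 1)} with hT
  have hle : ∀ q ∈ convexHull ℝ T, α * q.1 + β * q.2 ≤ m := by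
    have hlin : IsLinearMap ℝ fun q : ℝ × ℝ => α * q.1 + β * q.2 :=
      ⟨fun x y => by simp only [Prod.fst_add, Prod.snd_add]; ring,
        fun c x => by simp only [Prod.smul_fst, Prod.smul_snd, smul_eq_mul]; ring⟩
    refine convexHull_min ?_ (convex_halfSpace_le hlin m)
    rintro q (rfl | rfl | rfl)
    · change α * 0 + β * 0 ≤ m
      simp [hm]
    · change α * -t + β * 1 ≤ m
      have : β - α * t ≤ m := (le_max_left _ _).trans (le_max_right _ _)
      linarith
    · change α * -B + β * 1 ≤ m
      have : β - α * B ≤ m := (le_max_right _ _).trans (le_max_right _ _)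
      linarith
  obtain ⟨q, hq, hqm⟩ : ∃ q ∈ T, α * q.1 + β * q.2 = m := by
    rcases max_choice (0 : ℝ) (max (β - α * t) (β - α * B)) with h | h
    · exact ⟨(0, 0), by simp [hT], by rw [hm, h]; simp⟩
    · rcases max_choice (β - α * t) (β - α * B) with h' | h'
      · exact ⟨(-t, 1), by simp [hT], by rw [hm, h, h']; ring⟩
      · exact ⟨(-B, 1), by simp [hT], by rw [hm, h, h']; ring⟩
  have key : fiberSup P ℓ (ballTriangle J t B) = (closedBall (0 : Y) 1).indicator fun _ => m := by
    ext y
    by_cases hy : y ∈ closedBall (0 : Y) 1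
    · rw [Set.indicator_of_mem hy]
      have hmem : J (y, q) ∈ ballTriangle J t B := ⟨_, ⟨hy, subset_convexHull ℝ _ hq⟩, rfl⟩
      have := fiberSup_eq P ℓ hmem ?_
      · rwa [hP, hℓ, hqm] at this
      · rintro _ ⟨p, ⟨-, hp⟩, rfl⟩ -
        rw [hℓ, hℓ, hqm]
        exact hle _ hp
    · rw [Set.indicator_of_notMem hy, fiberSup_of_notMem]
      rintro ⟨_, ⟨p, ⟨hp, -⟩, rfl⟩, rfl⟩
      exact hy (by rwa [hP])
  rw [fiberIntegral, key, integral_indicator_const _ isClosed_closedBall.measurableSet,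
    smul_eq_mul]

theorem sliceVal_ballTriangle (hP : ∀ p, P (J p) = p.1) (h₁ : ∀ p, ℓ₁ (J p) = p.2.1)
    (h₂ : ∀ p, ℓ₂ (J p) = p.2.2) {s t B : ℝ} (ht : 0 ≤ t) (htB : t ≤ B) (hsB : s ≤ B) :
    sliceVal P ε ℓ₁ ℓ₂ s (ballTriangle J t B) =
      volume.real (closedBall (0 : Y) 1) * max 0 (s - t) := by
  have e₁ := fiberIntegral_ballTriangle hP (ℓ := ℓ₁ + s • ℓ₂) (α := 1) (β := s)
    (fun p => by simp [h₁, h₂]) t B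
  have e₂ := fiberIntegral_ballTriangle hP (ℓ := -(ℓ₁ + s • ℓ₂)) (α := -1) (β := -s)
    (fun p => by simp [h₁, h₂]; ring) t B
  have e₃ := fiberIntegral_ballTriangle hP (ℓ := ℓ₁) (α := 1) (β := 0)
    (fun p => by simp [h₁]) t B
  have e₄ := fiberIntegral_ballTriangle hP (ℓ := -ℓ₁) (α := -1) (β := 0)
    (fun p => by simp [h₁]) t B
  have e₅ := fiberIntegral_ballTriangle hP (ℓ := ℓ₂) (α := 0) (β := 1)
    (fun p => by simp [h₂]) t B
  have e₆ := fiberIntegral_ballTriangle hP (ℓ := -ℓ₂) (α := 0) (β := -1)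
    (fun p => by simp [h₂]) t B
  have m₁ : max 0 (max (s - 1 * t) (s - 1 * B)) = max 0 (s - t) := by
    rw [max_eq_left (a := s - 1 * t) (by linarith), one_mul]
  have m₂ : max 0 (max (-s - -1 * t) (-s - -1 * B)) = B - s := by
    rw [max_eq_right (a := -s - -1 * t) (by linarith), max_eq_right (by linarith)]
    ring
  have m₃ : max 0 (max (0 - 1 * t) (0 - 1 * B)) = 0 :=
    max_eq_left (max_le (by linarith) (by linarith))
  have m₄ : max 0 (max (0 - -1 * t) (0 - -1 * B)) = B := by
    rw [max_eq_right (a := 0 - -1 * t) (by linarith), max_eq_right (by linarith)]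
    ring
  have m₅ : max (0 : ℝ) (max (1 - 0 * t) (1 - 0 * B)) = 1 := by simp
  have m₆ : max (0 : ℝ) (max (-1 - 0 * t) (-1 - 0 * B)) = 0 := by simp
  rw [m₁] at e₁
  rw [m₂] at e₂
  rw [m₃] at e₃
  rw [m₄] at e₄
  rw [m₅] at e₅
  rw [m₆] at e₆
  rw [sliceVal, fiberWidth, fiberWidth, fiberWidth, e₁, e₂, e₃, e₄, e₅, e₆]
  ring

end FiberSup

/-- A sequence of functions that is triangular with respect to some points does not lie in a
finite-dimensional space of functions. -/
theorem not_forall_eq_sum_of_triangular {X : Type*} {d : ℕ} (b : Fin d → X → ℝ)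
    (f : Fin (d + 1) → X → ℝ) (x : Fin (d + 1) → X) (h_lt : ∀ i j, i < j → f i (x j) = 0)
    (h_self : ∀ i, f i (x i) ≠ 0) :
    ¬ ∀ i, ∃ c : Fin d → ℝ, ∀ z, f i z = ∑ j, c j * b j z := by
  intro h
  choose c hc using h
  have hdep : ¬ LinearIndependent ℝ c := fun hli => by
    have := hli.fintype_card_le_finrank
    simp at this
  obtain ⟨a, ha, i₀, hi₀⟩ := Fintype.not_linearIndependent_iff.1 hdep
  have hsum (z : X) : ∑ i, a i * f i z = 0 := by
    simp_rw [hc, Finset.mul_sum]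
    rw [Finset.sum_comm]
    refine Finset.sum_eq_zero fun j _ => ?_
    have := congrFun ha j
    simp only [Finset.sum_apply, Pi.smul_apply, smul_eq_mul, Pi.zero_apply] at this
    simp_rw [← mul_assoc]
    rw [← Finset.sum_mul, this, zero_mul]
  obtain ⟨i, hi, hmax⟩ := (Set.toFinite {i | a i ≠ 0}).exists_maximal ⟨i₀, hi₀⟩
  have hi_sum := hsum (x i)
  rw [Finset.sum_eq_single i] at hi_sum
  · exact (mul_ne_zero hi (h_self i)) hi_sum
  · intro j _ hji
    rcases lt_or_gt_of_ne hji with hlt | hgt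
    · rw [h_lt j i hlt, mul_zero]
    · by_cases hj : a j = 0
      · rw [hj, zero_mul]
      · exact absurd (hmax hj hgt.le) (not_le.2 hgt)
  · simp

/-- `ℝⁿ` splits off a `(k - 1)`-dimensional factor and two further coordinates. -/
theorem exists_projection_section {n k : ℕ} (hk0 : 0 < k) (hkn : k < n) :
    ∃ (P : Eucl n →L[ℝ] Eucl (k - 1)) (ℓ₁ ℓ₂ : Eucl n →L[ℝ] ℝ)
      (J : Eucl (k - 1) × ℝ × ℝ →L[ℝ] Eucl n),
      (∀ p, P (J p) = p.1) ∧ (∀ p, ℓ₁ (J p) = p.2.1) ∧ ∀ p, ℓ₂ (J p) = p.2.2 := by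
  let T : Eucl n →ₗ[ℝ] Eucl (k - 1) × ℝ × ℝ :=
    { toFun := fun x => (WithLp.toLp 2 fun i => x ⟨i + 2, by omega⟩,
        x ⟨0, by omega⟩, x ⟨1, by omega⟩)
      map_add' := fun x y => rfl
      map_smul' := fun c x => rfl }
  have hT_apply (x : Eucl n) : T x = (WithLp.toLp 2 fun i : Fin (k - 1) => x ⟨i + 2, by omega⟩,
      x ⟨0, by omega⟩, x ⟨1, by omega⟩) := rfl
  have hT : LinearMap.range T = ⊤ := by
    refine LinearMap.range_eq_top.2 fun p => ⟨WithLp.toLp 2 fun i =>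
      if (i : ℕ) = 0 then p.2.1 else if (i : ℕ) = 1 then p.2.2 else
        if h : (i : ℕ) - 2 < k - 1 then p.1 ⟨i - 2, h⟩ else 0, ?_⟩
    rw [hT_apply]
    refine Prod.ext ?_ (Prod.ext ?_ ?_)
    · ext i
      simp
    · simp
    · simp
  obtain ⟨J, hJ⟩ := T.exists_rightInverse_of_surjective hT
  have hTJ (p) : T (J p) = p := LinearMap.congr_fun hJ p
  let T' := LinearMap.toContinuousLinearMap T
  refine ⟨(ContinuousLinearMap.fst ℝ _ _).comp T',
    (ContinuousLinearMap.fst ℝ _ _).comp ((ContinuousLinearMap.snd ℝ _ _).comp T'),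
    (ContinuousLinearMap.snd ℝ _ _).comp ((ContinuousLinearMap.snd ℝ _ _).comp T'),
    LinearMap.toContinuousLinearMap J, fun p => ?_, fun p => ?_, fun p => ?_⟩
  · exact congrArg Prod.fst (hTJ p)
  · exact congrArg (fun q => q.2.1) (hTJ p)
  · exact congrArg (fun q => q.2.2) (hTJ p)

/-- The valuations of parity `ε = ±1` do not lie in a finite-dimensional space of functions. -/
theorem not_exists_span_of_parity {n k : ℕ} (hk0 : 0 < k) (hkn : k < n) {ε : ℝ}
    (hε : ε * ε = 1) :
    ¬ ∃ (d : ℕ) (b : Fin d → ConvexBody (Eucl n) → ℝ),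
      ∀ μ : ConvexBody (Eucl n) → ℝ,
        IsValuation μ → Continuous μ → TransInv μ → Homog k μ →
          (∀ K : ConvexBody (Eucl n), μ K.reflect = ε * μ K) →
            ∃ c : Fin d → ℝ, ∀ K : ConvexBody (Eucl n), μ K = ∑ i, c i * b i K := by
  rintro ⟨d, b, h⟩
  obtain ⟨P, ℓ₁, ℓ₂, J, hP, h₁, h₂⟩ := exists_projection_section hk0 hkn
  have hk : Module.finrank ℝ (Eucl (k - 1)) + 1 = k := by
    rw [finrank_euclideanSpace_fin]
    omega
  have hval (i j : Fin (d + 1)) :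
      sliceVal P ε ℓ₁ ℓ₂ ((i : ℝ) + 1) (ballTriangle J (j : ℝ) (d + 1)) =
        volume.real (closedBall (0 : Eucl (k - 1)) 1) * max 0 ((i : ℝ) + 1 - j) := by
    have hi : (i : ℝ) ≤ d := by exact_mod_cast Nat.lt_succ_iff.1 i.2
    have hj : (j : ℝ) ≤ d := by exact_mod_cast Nat.lt_succ_iff.1 j.2
    exact sliceVal_ballTriangle ε hP h₁ h₂ (Nat.cast_nonneg _) (by linarith) (by linarith)
  refine not_forall_eq_sum_of_triangular b
    (fun i : Fin (d + 1) => sliceVal P ε ℓ₁ ℓ₂ ((i : ℝ) + 1))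
    (fun j => ballTriangle J (j : ℝ) (d + 1)) (fun i j hij => ?_) (fun i => ?_) fun i => ?_
  · have hij' : (i : ℝ) + 1 ≤ j := by exact_mod_cast hij
    rw [hval, max_eq_left (by linarith), mul_zero]
  · have hpos : 0 < volume.real (closedBall (0 : Eucl (k - 1)) 1) :=
      ENNReal.toReal_pos (measure_closedBall_pos _ _ one_pos).ne'
        (isCompact_closedBall _ _).measure_lt_top.ne
    rw [hval]
    simpa using hpos.ne'
  · exact h _ (isValuation_sliceVal P ℓ₁ ℓ₂ ε _) (continuous_sliceVal P ℓ₁ ℓ₂ ε _)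
      (transInv_sliceVal P ℓ₁ ℓ₂ _ hε) (by simpa only [hk] using homog_sliceVal P ℓ₁ ℓ₂ ε _)
      (sliceVal_reflect P ℓ₁ ℓ₂ _ hε)

/-- For `0 < k < n`, the spaces `Val_k^+` and `Val_k^-` of continuous translation invariant
even (resp. odd) valuations on `ℝⁿ` homogeneous of degree `k` are infinite-dimensional:
neither is contained in the linear span of finitely many functions. -/
theorem val_k_infinite_dimensional (n k : ℕ) (hn : 2 ≤ n) (hk0 : 0 < k) (hkn : k < n) :
    (¬ ∃ (d : ℕ) (b : Fin d → ConvexBody (Eucl n) → ℝ),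
      ∀ μ : ConvexBody (Eucl n) → ℝ,
        IsValuation μ → Continuous μ → TransInv μ → Homog k μ → EvenVal μ →
          ∃ c : Fin d → ℝ, ∀ K : ConvexBody (Eucl n), μ K = ∑ i, c i * b i K) ∧
    (¬ ∃ (d : ℕ) (b : Fin d → ConvexBody (Eucl n) → ℝ),
      ∀ μ : ConvexBody (Eucl n) → ℝ,
        IsValuation μ → Continuous μ → TransInv μ → Homog k μ → OddVal μ →
          ∃ c : Fin d → ℝ, ∀ K : ConvexBody (Eucl n), μ K = ∑ i, c i * b i K) := by
  constructor
  · simpa only [EvenVal, one_mul] using not_exists_span_of_parity hk0 hkn (ε := 1) (by norm_num)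
  · simpa only [OddVal, neg_one_mul] using
      not_exists_span_of_parity hk0 hkn (ε := -1) (by norm_num)
end
end
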